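/- arXiv:2202.00933 — 4 statements merged into one kernel-verified Lean document; each statement's English description precedes it below -/
import Mathlib

section
/- Properties of the banded truncation (Lemma B.2). Fix K < ∞, κ > 1, 0 < λ_inf ≤ λ_sup < ∞, let p ∈ ℕ and let 𝐂 satisfy Assumption A(p, K, κ, λ_inf, λ_sup). Fix t ∈ ℤ and an integer M ≥ 2, let 𝐂_{tᶜ,tᶜ} be the compression of 𝐂 to ℓ²(ℤ∖{t}; ℝ^p), and let 𝐁_M be its banded truncation with bandwidth M, i.e. (𝐁_M)_{s₁,s₂} = (𝐂_{tᶜ,tᶜ})_{s₁,s₂} if |s₁ − s₂| ≤ M and (𝐁_M)_{s₁,s₂} = 0 otherwise (s₁, s₂ ∈ ℤ∖{t}). Then: (a) ‖𝐂_{tᶜ,tᶜ} − 𝐁_M‖₂ ≤ (2K/(κ−1)) (M−1)^{−κ+1}; (b) for every v ∈ ℓ²(ℤ∖{t}; ℝ^p), (λ_inf − (2K/(κ−1))(M−1)^{−κ+1})‖v‖² ≤ ⟨v, 𝐁_M v⟩ ≤ (λ_sup + (2K/(κ−1))(M−1)^{−κ+1})‖v‖²; (c) if λ_inf − (2K/(κ−1))(M−1)^{−κ+1}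 > 0, then 𝐁_M is boundedly invertible and ‖𝐁_M⁻¹‖₂ ≤ (λ_inf − (2K/(κ−1))(M−1)^{−κ+1})⁻¹. -/
noncomputable section

/-- `⟨x⟩ = max(1,|x|)` -/
def gu (x : ℝ) : ℝ := max 1 |x|

/-- `ζ(x) = max(1, log⟨x⟩)/⟨x⟩` -/
def zeta (x : ℝ) : ℝ := max 1 (Real.log (gu x)) / gu x

/-- spectral norm of a matrix -/
def specNorm {𝕜 : Type*} [RCLike 𝕜] {m n : Type*} [Fintype m] [Fintype n] [DecidableEq n]
    (M : Matrix m n 𝕜) : ℝ :=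
  ‖LinearMap.toContinuousLinearMap (Matrix.toEuclideanLin M)‖

/-- `ℓ²(ι; ℝ^p)` -/
abbrev HpI (ι : Type) (p : ℕ) : Type := lp (fun _ : ι => EuclideanSpace ℝ (Fin p)) 2

abbrev Hp (p : ℕ) : Type := HpI ℤ p

/-- the sequence `δ_t ⊗ e_a` -/
def bvec {ι : Type} [DecidableEq ι] (p : ℕ) (t : ι) (a : Fin p) : HpI ι p :=
  lp.single 2 t (EuclideanSpace.single a 1)

/-- the `p × p` block `A_{t,τ}` of an operator -/
def blk {ι : Type} [DecidableEq ι] {p : ℕ} (A : HpI ι p →L[ℝ] HpI ι p) (t τ : ι) :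
    Matrix (Fin p) (Fin p) ℝ :=
  Matrix.of fun a b => inner (𝕜 := ℝ) (bvec p t a) (A (bvec p τ b))

/-- Assumption A(p, K, κ, λ_inf, λ_sup): a bounded self-adjoint operator on `H_p` whose
quadratic form is bounded between `λ_inf` and `λ_sup` and whose off-diagonal blocks decay
at the rate `K⟨t−τ⟩^{−κ}`. -/
structure AssumptionA (p : ℕ) (K κ lamInf lamSup : ℝ) (C : Hp p →L[ℝ] Hp p) : Prop where
  symm : ∀ x y : Hp p, inner (𝕜 := ℝ) (C x) y = inner (𝕜 := ℝ) x (C y)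
  lower : ∀ v : Hp p, lamInf * ‖v‖ ^ 2 ≤ inner (𝕜 := ℝ) v (C v)
  upper : ∀ v : Hp p, inner (𝕜 := ℝ) v (C v) ≤ lamSup * ‖v‖ ^ 2
  decay : ∀ t τ : ℤ, t ≠ τ → specNorm (blk C t τ) ≤ K * gu ((t : ℝ) - (τ : ℝ)) ^ (-κ)


/-- The entries of an operator against single-site vectors are given by its blocks. -/
theorem inner_single_apply_single {ι : Type} [DecidableEq ι] {p : ℕ}
    (A : HpI ι p →L[ℝ] HpI ι p) (s r : ι) (u w : EuclideanSpace ℝ (Fin p)) :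
    inner ℝ (lp.single 2 s u : HpI ι p) (A (lp.single 2 r w)) =
      inner ℝ u (Matrix.toEuclideanLin (blk A s r) w) := by
  have key : ∀ (i : ι) (z : EuclideanSpace ℝ (Fin p)),
      (lp.single 2 i z : HpI ι p) = ∑ a, z a • bvec p i a := by
    intro i z
    have hz : z = ∑ a, z a • EuclideanSpace.single a (1 : ℝ) := by
      ext b
      simp [Finset.sum_apply, Pi.single_apply]
    conv_lhs => rw [hz]
    simp only [bvec, ← lp.single_smul]
    exact map_sum (lp.singleAddMonoidHom (E := fun _ : ι => EuclideanSpace ℝ (Fin p)) 2 i) _ _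
  rw [key s u, key r w]
  simp only [map_sum, map_smul, sum_inner, inner_sum, real_inner_smul_left, real_inner_smul_right]
  simp only [PiLp.inner_apply, Matrix.toEuclideanLin, blk]
  simp only [Matrix.toLpLin_apply, Matrix.mulVec, dotProduct, Matrix.of_apply, RCLike.inner_apply,
    conj_trivial, Finset.sum_mul]
  rw [Finset.sum_comm]
  exact Finset.sum_congr rfl fun a _ => Finset.sum_congr rfl fun b _ => by ring

theorem inner_single_apply_single_le {ι : Type} [DecidableEq ι] {p : ℕ}
    (A : HpI ι p →L[ℝ] HpI ι p) (s r : ι) (u w : EuclideanSpace ℝ (Fin p)) :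
    inner ℝ (lp.single 2 s u : HpI ι p) (A (lp.single 2 r w)) ≤
      specNorm (blk A s r) * (‖u‖ * ‖w‖) := by
  rw [inner_single_apply_single]
  calc _ ≤ ‖u‖ * ‖Matrix.toEuclideanLin (blk A s r) w‖ := real_inner_le_norm _ _
    _ ≤ ‖u‖ * (specNorm (blk A s r) * ‖w‖) := by
        gcongr
        exact (LinearMap.toContinuousLinearMap (Matrix.toEuclideanLin (blk A s r))).le_opNorm w
    _ = _ := by ring

/-- The restriction of a sequence to a finite set of sites. -/
def finTrunc {ι : Type} [DecidableEq ι] {p : ℕ} (v : HpI ι p) (F : Finset ι) : HpI ι p :=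
  ∑ s ∈ F, lp.single 2 s (v s)

theorem tendsto_finTrunc {ι : Type} [DecidableEq ι] {p : ℕ} (v : HpI ι p) :
    Filter.Tendsto (finTrunc v) Filter.atTop (nhds v) :=
  lp.hasSum_single (by norm_num) v

theorem norm_sq_sum_single {ι : Type} [DecidableEq ι] {p : ℕ}
    (f : ι → EuclideanSpace ℝ (Fin p)) (F : Finset ι) :
    ‖(∑ s ∈ F, lp.single 2 s (f s) : HpI ι p)‖ ^ 2 = ∑ s ∈ F, ‖f s‖ ^ 2 := by
  have := lp.norm_sum_single (E := fun _ : ι => EuclideanSpace ℝ (Fin p)) (p := 2) (by norm_num) f F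
  simpa using this

theorem sum_norm_sq_le {ι : Type} [DecidableEq ι] {p : ℕ} (v : HpI ι p) (F : Finset ι) :
    ∑ s ∈ F, ‖v s‖ ^ 2 ≤ ‖v‖ ^ 2 := by
  have := lp.sum_rpow_le_norm_rpow (p := 2) (by norm_num) v F
  simpa using this

/-- Schur's test for the blocks of an operator. -/
theorem norm_le_of_blk_sum_le {ι : Type} [DecidableEq ι] {p : ℕ}
    (A : HpI ι p →L[ℝ] HpI ι p) (S : ℝ) (hS : 0 ≤ S)
    (hrow : ∀ s, ∀ F : Finset ι, ∑ r ∈ F, specNorm (blk A s r) ≤ S)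
    (hcol : ∀ r, ∀ F : Finset ι, ∑ s ∈ F, specNorm (blk A s r) ≤ S) : ‖A‖ ≤ S := by
  have hfin : ∀ (x y : HpI ι p) (F : Finset ι),
      inner ℝ (finTrunc x F) (A (finTrunc y F)) ≤ S * ((‖x‖ ^ 2 + ‖y‖ ^ 2) / 2) := by
    intro x y F
    simp only [finTrunc, map_sum, sum_inner, inner_sum]
    have h1 : ∑ s ∈ F, ∑ r ∈ F, specNorm (blk A s r) * (‖x s‖ ^ 2 / 2) ≤ S * (‖x‖ ^ 2 / 2) := by
      calc _ = ∑ s ∈ F, (∑ r ∈ F, specNorm (blk A s r)) * (‖x s‖ ^ 2 / 2) := by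
            simp only [Finset.sum_mul]
        _ ≤ ∑ s ∈ F, S * (‖x s‖ ^ 2 / 2) := by
            gcongr with s
            exact hrow s F
        _ = S * ((∑ s ∈ F, ‖x s‖ ^ 2) / 2) := by rw [← Finset.mul_sum, Finset.sum_div]
        _ ≤ _ := by
            gcongr
            exact sum_norm_sq_le x F
    have h2 : ∑ s ∈ F, ∑ r ∈ F, specNorm (blk A s r) * (‖y r‖ ^ 2 / 2) ≤ S * (‖y‖ ^ 2 / 2) := by
      rw [Finset.sum_comm]
      calc _ = ∑ r ∈ F, (∑ s ∈ F, specNorm (blk A s r)) * (‖y r‖ ^ 2 / 2) := by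
            simp only [Finset.sum_mul]
        _ ≤ ∑ s ∈ F, S * (‖y s‖ ^ 2 / 2) := by
            gcongr with s
            exact hcol s F
        _ = S * ((∑ s ∈ F, ‖y s‖ ^ 2) / 2) := by rw [← Finset.mul_sum, Finset.sum_div]
        _ ≤ _ := by
            gcongr
            exact sum_norm_sq_le y F
    calc _ ≤ ∑ s ∈ F, ∑ r ∈ F, (specNorm (blk A s r) * (‖x s‖ ^ 2 / 2) +
          specNorm (blk A s r) * (‖y r‖ ^ 2 / 2)) := by
          rw [Finset.sum_comm]
          refine Finset.sum_le_sum fun s _ => Finset.sum_le_sum fun r _ => ?_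
          refine (inner_single_apply_single_le A s r (x s) (y r)).trans ?_
          rw [← mul_add]
          refine mul_le_mul_of_nonneg_left ?_ (norm_nonneg _)
          nlinarith [sq_nonneg (‖x s‖ - ‖y r‖)]
      _ ≤ _ := by
          simp only [Finset.sum_add_distrib]
          linarith
  have hall : ∀ x y : HpI ι p, inner ℝ x (A y) ≤ S * ((‖x‖ ^ 2 + ‖y‖ ^ 2) / 2) := fun x y =>
    le_of_tendsto ((tendsto_finTrunc x).inner ((A.continuous.tendsto y).comp (tendsto_finTrunc y)))
      (Filter.Eventually.of_forall (hfin x y))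
  refine A.opNorm_le_bound hS fun y => ?_
  rcases hS.eq_or_lt with h0 | hpos
  · have := hall (A y) y
    rw [← h0, zero_mul, real_inner_self_eq_norm_sq] at this
    rw [← h0, zero_mul]
    nlinarith [norm_nonneg (A y)]
  · have := hall (S⁻¹ • A y) y
    rw [real_inner_smul_left, real_inner_self_eq_norm_sq, norm_smul, Real.norm_eq_abs,
      abs_of_pos (inv_pos.2 hpos)] at this
    refine le_of_sq_le_sq ?_ (by positivity)
    field_simp at this
    nlinarith

theorem sum_range_rpow_neg_le {κ : ℝ} (hκ : 1 < κ) {M : ℕ} (hM : 1 ≤ M) (n : ℕ) :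
    ∑ i ∈ Finset.range n, ((M : ℝ) + ((i + 1 : ℕ) : ℝ)) ^ (-κ) ≤ (M : ℝ) ^ (-κ + 1) / (κ - 1) := by
  have hM0 : (0 : ℝ) < M := by exact_mod_cast hM
  have hanti : AntitoneOn (fun x : ℝ => x ^ (-κ)) (Set.Icc (M : ℝ) (M + n)) := by
    intro x hx y hy hxy
    exact Real.rpow_le_rpow_of_nonpos (hM0.trans_le hx.1) hxy (by linarith)
  refine hanti.sum_le_integral.trans ?_
  rw [integral_rpow (Or.inr ⟨by linarith, ?_⟩)]
  · have : (0 : ℝ) ≤ ((M : ℝ) + n) ^ (-κ + 1) := by positivity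
    rw [← neg_div_neg_eq, neg_add_rev, neg_neg, add_comm (-1) κ, ← sub_eq_add_neg]
    refine div_le_div_of_nonneg_right ?_ (by linarith)
    linarith
  · rw [Set.uIcc_of_le (by linarith [n.cast_nonneg (α := ℝ)])]
    exact fun h => absurd h.1 (by linarith)

theorem sum_int_rpow_neg_le {κ : ℝ} (hκ : 1 < κ) {M : ℕ} (hM : 1 ≤ M) (G : Finset ℤ)
    (hG : ∀ d ∈ G, (M : ℤ) < |d|) :
    ∑ d ∈ G, |(d : ℝ)| ^ (-κ) ≤ 2 * ((M : ℝ) ^ (-κ + 1) / (κ - 1)) := by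
  obtain ⟨n, hn⟩ : ∃ n : ℕ, ∀ d ∈ G, d.natAbs ≤ n :=
    ⟨G.sup Int.natAbs, fun d hd => Finset.le_sup (f := Int.natAbs) hd⟩
  set P : Finset ℤ := (Finset.range n).image fun i : ℕ => (M : ℤ) + ((i + 1 : ℕ) : ℤ) with hP
  set N : Finset ℤ := (Finset.range n).image fun i : ℕ => -((M : ℤ) + ((i + 1 : ℕ) : ℤ)) with hN
  have hsub : G ⊆ P ∪ N := by
    intro d hd
    have h1 := hG d hd
    have h2 := hn d hd
    simp only [hP, hN, Finset.mem_union, Finset.mem_image, Finset.mem_range]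
    rcases le_total 0 d with h | h
    · rw [abs_of_nonneg h] at h1
      exact Or.inl ⟨d.natAbs - M - 1, by omega, by omega⟩
    · rw [abs_of_nonpos h] at h1
      exact Or.inr ⟨d.natAbs - M - 1, by omega, by omega⟩
  have hpos : ∀ d : ℤ, 0 ≤ |(d : ℝ)| ^ (-κ) := fun d => by positivity
  have hsP : ∑ d ∈ P, |(d : ℝ)| ^ (-κ) ≤ (M : ℝ) ^ (-κ + 1) / (κ - 1) := by
    rw [hP, Finset.sum_image (by intro a _ b _ h; simpa using h)]
    refine le_of_eq_of_le (Finset.sum_congr rfl fun i _ => ?_) (sum_range_rpow_neg_le hκ hM n)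
    rw [← Int.cast_abs, abs_of_nonneg (by positivity)]
    push_cast; rfl
  have hsN : ∑ d ∈ N, |(d : ℝ)| ^ (-κ) ≤ (M : ℝ) ^ (-κ + 1) / (κ - 1) := by
    rw [hN, Finset.sum_image (by intro a _ b _ h; simpa using h)]
    refine le_of_eq_of_le (Finset.sum_congr rfl fun i _ => ?_) (sum_range_rpow_neg_le hκ hM n)
    rw [← Int.cast_abs, abs_neg, abs_of_nonneg (by positivity)]
    push_cast; rfl
  calc _ ≤ ∑ d ∈ P ∪ N, |(d : ℝ)| ^ (-κ) :=
        Finset.sum_le_sum_of_subset_of_nonneg hsub fun d _ _ => hpos d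
    _ ≤ ∑ d ∈ P, |(d : ℝ)| ^ (-κ) + ∑ d ∈ N, |(d : ℝ)| ^ (-κ) := by
        rw [← Finset.sum_union_inter]
        exact le_add_of_nonneg_right (Finset.sum_nonneg fun d _ => hpos d)
    _ ≤ _ := by linarith

/-- Compressing an operator to a subset of sites preserves its quadratic form on finitely
supported sequences. -/
theorem inner_finTrunc_of_blk_eq {p : ℕ} {q : ℤ → Prop}
    (C : Hp p →L[ℝ] Hp p) (A : HpI {x : ℤ // q x} p →L[ℝ] HpI {x : ℤ // q x} p)
    (hA : ∀ s₁ s₂ : {x : ℤ // q x}, blk A s₁ s₂ = blk C (s₁ : ℤ) (s₂ : ℤ))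
    (v : HpI {x : ℤ // q x} p) (F : Finset {x : ℤ // q x}) :
    ∃ w : Hp p, ‖w‖ ^ 2 = ‖finTrunc v F‖ ^ 2 ∧
      inner ℝ w (C w) = inner ℝ (finTrunc v F) (A (finTrunc v F)) := by
  classical
  refine ⟨∑ s ∈ F, lp.single 2 (s : ℤ) (v s), ?_, ?_⟩
  · let f : ℤ → EuclideanSpace ℝ (Fin p) := fun x => if h : q x then v ⟨x, h⟩ else 0
    have hf : ∀ s : {x : ℤ // q x}, f s = v s := fun s => by simp [f, s.2]
    have := norm_sq_sum_single f (F.map (Function.Embedding.subtype q))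
    simp only [Finset.sum_map, Function.Embedding.coe_subtype, hf] at this
    rw [this, finTrunc, norm_sq_sum_single]
  · simp only [finTrunc, map_sum, sum_inner, inner_sum, inner_single_apply_single, hA]

/-- The compression of an operator to a subset of sites inherits its quadratic form bounds. -/
theorem quadratic_form_bounds_of_blk_eq {p : ℕ} {q : ℤ → Prop} {a b : ℝ}
    (C : Hp p →L[ℝ] Hp p) (A : HpI {x : ℤ // q x} p →L[ℝ] HpI {x : ℤ // q x} p)
    (hA : ∀ s₁ s₂ : {x : ℤ // q x}, blk A s₁ s₂ = blk C (s₁ : ℤ) (s₂ : ℤ))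
    (ha : ∀ w, a * ‖w‖ ^ 2 ≤ inner ℝ w (C w)) (hb : ∀ w, inner ℝ w (C w) ≤ b * ‖w‖ ^ 2)
    (v : HpI {x : ℤ // q x} p) :
    a * ‖v‖ ^ 2 ≤ inner ℝ v (A v) ∧ inner ℝ v (A v) ≤ b * ‖v‖ ^ 2 := by
  have hlim := tendsto_finTrunc v
  have hform := hlim.inner (𝕜 := ℝ) ((A.continuous.tendsto v).comp hlim)
  have hnorm := fun c : ℝ => (hlim.norm.pow 2).const_mul c
  constructor
  · refine le_of_tendsto_of_tendsto' (hnorm a) hform fun F => ?_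
    obtain ⟨w, hw, hw'⟩ := inner_finTrunc_of_blk_eq C A hA v F
    simpa only [Function.comp, ← hw, ← hw'] using ha w
  · refine le_of_tendsto_of_tendsto' hform (hnorm b) fun F => ?_
    obtain ⟨w, hw, hw'⟩ := inner_finTrunc_of_blk_eq C A hA v F
    simpa only [Function.comp, ← hw, ← hw'] using hb w

/-- A bounded operator whose quadratic form is bounded below by `c > 0` has a bounded inverse of
norm at most `c⁻¹`. -/
theorem exists_inverse_of_le_inner {H : Type*} [NormedAddCommGroup H] [InnerProductSpace ℝ H]
    [CompleteSpace H] (B : H →L[ℝ] H) {c : ℝ} (hc : 0 < c)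
    (hB : ∀ v, c * ‖v‖ ^ 2 ≤ inner ℝ v (B v)) :
    ∃ Binv : H →L[ℝ] H, B.comp Binv = ContinuousLinearMap.id ℝ _ ∧
      Binv.comp B = ContinuousLinearMap.id ℝ _ ∧ ‖Binv‖ ≤ c⁻¹ := by
  have hunit : IsUnit B := by
    refine ContinuousLinearMap.isUnit_of_forall_le_norm_inner_map B (c := ⟨c, hc.le⟩) hc fun x => ?_
    rw [real_inner_comm, mul_comm]
    exact (hB x).trans (le_abs_self _)
  obtain ⟨u, rfl⟩ := hunit
  have h1 : (u : H →L[ℝ] H).comp (↑u⁻¹ : H →L[ℝ] H) = ContinuousLinearMap.id ℝ _ := u.mul_inv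
  refine ⟨↑u⁻¹, h1, u.inv_mul, ContinuousLinearMap.opNorm_le_bound _ (by positivity) fun y => ?_⟩
  set x := (↑u⁻¹ : H →L[ℝ] H) y with hx
  have hux : (u : H →L[ℝ] H) x = y := congrArg (fun T : H →L[ℝ] H => T y) h1
  have h2 : c * ‖x‖ ^ 2 ≤ ‖x‖ * ‖y‖ := by
    simpa only [hux] using (hB x).trans (real_inner_le_norm x ((u : H →L[ℝ] H) x))
  rw [inv_mul_eq_div, le_div_iff₀ hc]
  rcases (norm_nonneg x).eq_or_lt with h0 | hpos
  · rw [← h0, zero_mul]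
    exact norm_nonneg y
  · nlinarith

theorem blk_sub {ι : Type} [DecidableEq ι] {p : ℕ} (A B : HpI ι p →L[ℝ] HpI ι p) (s r : ι) :
    blk (A - B) s r = blk A s r - blk B s r := by
  ext a b
  simp [blk, inner_sub_right]

theorem specNorm_zero {p : ℕ} : specNorm (0 : Matrix (Fin p) (Fin p) ℝ) = 0 := by
  simp [specNorm]

/-- Lemma B.2: properties of the banded truncation `𝐁_M` of the compression
`𝐂_{tᶜ,tᶜ}` of `𝐂` to `ℓ²(ℤ∖{t}; ℝ^p)`. -/
theorem banded_truncation_properties (K κ lamInf lamSup : ℝ)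
    (hκ : 1 < κ) (hInf : 0 < lamInf) (hle : lamInf ≤ lamSup)
    (p : ℕ) (hp : 1 ≤ p) (C : Hp p →L[ℝ] Hp p) (hC : AssumptionA p K κ lamInf lamSup C)
    (t : ℤ) (M : ℕ) (hM : 2 ≤ M)
    (Ctc : HpI {x : ℤ // x ≠ t} p →L[ℝ] HpI {x : ℤ // x ≠ t} p)
    (hCtc : ∀ s₁ s₂ : {x : ℤ // x ≠ t}, blk Ctc s₁ s₂ = blk C (s₁ : ℤ) (s₂ : ℤ))
    (BM : HpI {x : ℤ // x ≠ t} p →L[ℝ] HpI {x : ℤ // x ≠ t} p)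
    (hBM : ∀ s₁ s₂ : {x : ℤ // x ≠ t},
      blk BM s₁ s₂ = if |(s₁ : ℤ) - (s₂ : ℤ)| ≤ (M : ℤ) then blk Ctc s₁ s₂ else 0) :
    ‖Ctc - BM‖ ≤ 2 * K / (κ - 1) * ((M : ℝ) - 1) ^ (-κ + 1) ∧
    (∀ v : HpI {x : ℤ // x ≠ t} p,
      (lamInf - 2 * K / (κ - 1) * ((M : ℝ) - 1) ^ (-κ + 1)) * ‖v‖ ^ 2 ≤
        inner (𝕜 := ℝ) v (BM v) ∧
      inner (𝕜 := ℝ) v (BM v) ≤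
        (lamSup + 2 * K / (κ - 1) * ((M : ℝ) - 1) ^ (-κ + 1)) * ‖v‖ ^ 2) ∧
    (0 < lamInf - 2 * K / (κ - 1) * ((M : ℝ) - 1) ^ (-κ + 1) →
      ∃ Binv : HpI {x : ℤ // x ≠ t} p →L[ℝ] HpI {x : ℤ // x ≠ t} p,
        BM.comp Binv = ContinuousLinearMap.id ℝ _ ∧
        Binv.comp BM = ContinuousLinearMap.id ℝ _ ∧
        ‖Binv‖ ≤ (lamInf - 2 * K / (κ - 1) * ((M : ℝ) - 1) ^ (-κ + 1))⁻¹) := by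
  set S : ℝ := 2 * K / (κ - 1) * ((M : ℝ) - 1) ^ (-κ + 1) with hSdef
  have hM' : (2 : ℝ) ≤ M := by exact_mod_cast hM
  have hK : 0 ≤ K := by
    have := (norm_nonneg _).trans (hC.decay 0 1 (by norm_num))
    simpa [gu] using this
  have hS : 0 ≤ S := mul_nonneg (div_nonneg (by linarith) (by linarith))
    (Real.rpow_nonneg (by linarith) _)
  have hblk : ∀ s r : {x : ℤ // x ≠ t}, specNorm (blk (Ctc - BM) s r) ≤
      if (M : ℤ) < |(s : ℤ) - r| then K * |(((s : ℤ) - r : ℤ) : ℝ)| ^ (-κ) else 0 := by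
    intro s r
    rw [blk_sub, hBM]
    by_cases h : |(s : ℤ) - (r : ℤ)| ≤ (M : ℤ)
    · rw [if_pos h, if_neg h.not_gt, sub_self, specNorm_zero]
    · rw [if_neg h, if_pos (not_le.1 h), sub_zero, hCtc]
      have hne : (s : ℤ) ≠ r := fun he => h (by simp [he])
      have h1 : (1 : ℝ) ≤ |(((s : ℤ) - r : ℤ) : ℝ)| := by
        rw [← Int.cast_abs]
        exact_mod_cast Int.one_le_abs (sub_ne_zero.2 hne)
      have := hC.decay s r hne
      rwa [← Int.cast_sub, gu, max_eq_right h1] at this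
  have hsum : ∀ (e : {x : ℤ // x ≠ t} → ℤ), Function.Injective e → ∀ F : Finset {x : ℤ // x ≠ t},
      ∑ r ∈ F, (if (M : ℤ) < |e r| then K * |(e r : ℝ)| ^ (-κ) else 0) ≤ S := by
    intro e he F
    rw [← Finset.sum_image (f := fun d : ℤ => if (M : ℤ) < |d| then K * |(d : ℝ)| ^ (-κ) else 0)
      he.injOn, ← Finset.sum_filter, ← Finset.mul_sum]
    calc _ ≤ K * (2 * ((M : ℝ) ^ (-κ + 1) / (κ - 1))) := by
          gcongr
          exact sum_int_rpow_neg_le hκ (by omega) _ fun d hd => (Finset.mem_filter.1 hd).2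
      _ = 2 * K / (κ - 1) * (M : ℝ) ^ (-κ + 1) := by ring
      _ ≤ S := mul_le_mul_of_nonneg_left
          (Real.rpow_le_rpow_of_nonpos (by linarith) (by linarith) (by linarith))
          (div_nonneg (by linarith) (by linarith))
  have hnorm : ‖Ctc - BM‖ ≤ S := by
    refine norm_le_of_blk_sum_le _ S hS (fun s F => ?_) fun r F => ?_
    · exact (Finset.sum_le_sum fun r _ => hblk s r).trans
        (hsum (fun r => (s : ℤ) - r) (fun a b h => Subtype.ext (sub_right_injective h)) F)
    · exact (Finset.sum_le_sum fun s _ => hblk s r).trans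
        (hsum (fun s => (s : ℤ) - r) (fun a b h => Subtype.ext (sub_left_injective h)) F)
  have hform : ∀ v : HpI {x : ℤ // x ≠ t} p,
      (lamInf - S) * ‖v‖ ^ 2 ≤ inner ℝ v (BM v) ∧
        inner ℝ v (BM v) ≤ (lamSup + S) * ‖v‖ ^ 2 := by
    intro v
    obtain ⟨h1, h2⟩ := quadratic_form_bounds_of_blk_eq C Ctc hCtc hC.lower hC.upper v
    have h3 : |inner ℝ v ((Ctc - BM) v)| ≤ S * ‖v‖ ^ 2 :=
      calc _ ≤ ‖v‖ * ‖(Ctc - BM) v‖ := abs_real_inner_le_norm _ _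
        _ ≤ ‖v‖ * (S * ‖v‖) := by
            gcongr
            exact (Ctc - BM).le_of_opNorm_le hnorm v
        _ = _ := by ring
    rw [sub_apply, inner_sub_right] at h3
    obtain ⟨h4, h5⟩ := abs_le.1 h3
    constructor <;> linarith
  exact ⟨hnorm, hform, fun hpos => exists_inverse_of_le_inner BM hpos fun v => (hform v).1⟩
end
end

section
/- Positive definiteness of the local approximating covariance (Theorem 3.1). Suppose Assumption LS(p, K, κ, λ_inf, λ_sup, N₀) holds. Then for every u ∈ ℝ the block Toeplitz operator 𝐂(u) on H_p (with blocks (𝐂(u))_{t,τ} = C_{t−τ}(u)) is a bounded self-adjoint operator satisfying λ_inf‖v‖² ≤ ⟨v, 𝐂(u)v⟩ ≤ λ_sup‖v‖² for all v ∈ H_p; in particular {C_r(u)}_{r∈ℤ} is a positive definite autocovariance sequence. -/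
noncomputable section

/-- Assumption LS(p, K, κ, λ_inf, λ_sup, N₀): a locally stationary family of covariance
operators `𝐂^(N)` together with the smooth local autocovariance functions `C_r(·)`. -/
structure AssumptionLS (p : ℕ) (K κ lamInf lamSup : ℝ) (N₀ : ℕ)
    (C : ℕ → Hp p →L[ℝ] Hp p) (Cr : ℤ → ℝ → Matrix (Fin p) (Fin p) ℝ) : Prop where
  symm : ∀ (N : ℕ) (x y : Hp p), inner (𝕜 := ℝ) ((C N) x) y = inner (𝕜 := ℝ) x ((C N) y)
  lower : ∀ N : ℕ, N₀ ≤ N → ∀ v : Hp p, lamInf * ‖v‖ ^ 2 ≤ inner (𝕜 := ℝ) v ((C N) v)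
  upper : ∀ N : ℕ, N₀ ≤ N → ∀ v : Hp p, inner (𝕜 := ℝ) v ((C N) v) ≤ lamSup * ‖v‖ ^ 2
  decay : ∀ N : ℕ, 1 ≤ N → ∀ t τ : ℤ,
    specNorm (blk (C N) t τ) ≤ K * gu ((t : ℝ) - (τ : ℝ)) ^ (-κ)
  crSymm : ∀ (r : ℤ) (u : ℝ), Cr r u = (Cr (-r) u).transpose
  crBound : ∀ (r : ℤ) (u : ℝ), specNorm (Cr r u) ≤ K * gu (r : ℝ) ^ (-κ)
  crLip : ∀ (r : ℤ) (u v : ℝ),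
    specNorm (Cr r u - Cr r v) ≤ K * |u - v| * gu (r : ℝ) ^ (-κ)
  approx : ∀ N : ℕ, 1 ≤ N → ∀ t τ : ℤ,
    specNorm (blk (C N) t τ - Cr (t - τ) ((t : ℝ) / (N : ℝ))) ≤
      K * gu ((t : ℝ) - (τ : ℝ)) ^ (-κ + 1) *
        min (1 / (N : ℝ)) (2 / gu ((t : ℝ) - (τ : ℝ)))

open Filter Topology InnerProductSpace

/-- Along an ultrafilter, every eventually norm bounded family of operators on a real Hilbert space
converges in the weak operator topology. -/
lemma ContinuousLinearMap.exists_tendsto_inner_of_eventually_norm_le {ι H : Type*}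
    [NormedAddCommGroup H] [InnerProductSpace ℝ H] [CompleteSpace H] (U : Ultrafilter ι)
    (A : ι → H →L[ℝ] H) (c : ℝ) (hA : ∀ᶠ i in (U : Filter ι), ‖A i‖ ≤ c) :
    ∃ B : H →L[ℝ] H, ∀ x y : H,
      Tendsto (fun i => inner ℝ x (A i y)) U (𝓝 (inner ℝ x (B y))) := by
  have hbound (y x : H) : ∀ᶠ i in (U : Filter ι), ‖inner ℝ x (A i y)‖ ≤ c * ‖y‖ * ‖x‖ := by
    filter_upwards [hA] with i hi
    calc ‖inner ℝ x (A i y)‖ ≤ ‖x‖ * ‖A i y‖ := norm_inner_le_norm _ _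
      _ ≤ ‖x‖ * (c * ‖y‖) := by gcongr; exact (A i).le_of_opNorm_le hi y
      _ = c * ‖y‖ * ‖x‖ := by ring
  have hlim (y x : H) : ∃ l : ℝ, Tendsto (fun i => inner ℝ x (A i y)) U (𝓝 l) := by
    obtain ⟨l, -, hl⟩ := (isCompact_closedBall (0 : ℝ) (c * ‖y‖ * ‖x‖)).ultrafilter_le_nhds
      (U.map fun i => inner ℝ x (A i y)) (le_principal_iff.mpr <|
        (hbound y x).mono fun i hi => by simpa using hi)
    exact ⟨l, hl⟩
  choose b hb using hlim
  let L : H →ₗ[ℝ] H →ₗ[ℝ] ℝ := LinearMap.mk₂ ℝ b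
    (fun y y' x => tendsto_nhds_unique (hb _ _) (by
      simpa [inner_add_right] using (hb y x).add (hb y' x)))
    (fun r y x => tendsto_nhds_unique (hb _ _) (by
      simpa [inner_smul_right] using (hb y x).const_mul r))
    (fun y x x' => tendsto_nhds_unique (hb _ _) (by
      simpa [inner_add_left] using (hb y x).add (hb y x')))
    (fun r y x => tendsto_nhds_unique (hb _ _) (by
      simpa [real_inner_smul_left] using (hb y x).const_mul r))
  let B : H →L[ℝ] H →L[ℝ] ℝ := L.mkContinuous₂ c fun y x =>
    le_of_tendsto (hb y x).norm (hbound y x)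
  refine ⟨continuousLinearMapOfBilin (𝕜 := ℝ) B, fun x y => ?_⟩
  rw [real_inner_comm, continuousLinearMapOfBilin_apply]
  exact hb y x

/-- A symmetric operator whose quadratic form lies between `0` and `c ‖·‖²` has norm at most `c`. -/
lemma ContinuousLinearMap.norm_le_of_inner_self_le {H : Type*}
    [NormedAddCommGroup H] [InnerProductSpace ℝ H] {T : H →L[ℝ] H} {c : ℝ} (hc : 0 ≤ c)
    (hT : (T : H →ₗ[ℝ] H).IsSymmetric) (h0 : ∀ v, 0 ≤ inner ℝ v (T v))
    (h1 : ∀ v, inner ℝ v (T v) ≤ c * ‖v‖ ^ 2) : ‖T‖ ≤ c := by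
  rw [T.norm_eq_iSup_rayleighQuotient hT]
  refine ciSup_le fun v => ?_
  have hq : T.reApplyInnerSelf v = inner ℝ v (T v) := by
    simp [ContinuousLinearMap.reApplyInnerSelf_apply, real_inner_comm]
  rw [ContinuousLinearMap.rayleighQuotient, hq, abs_of_nonneg (div_nonneg (h0 v) (sq_nonneg _))]
  exact div_le_of_le_mul₀ (sq_nonneg _) hc (h1 v)

/-- Entries of a matrix are bounded by its spectral norm. -/
lemma abs_entry_le_specNorm {m n : Type*} [Fintype m] [Fintype n] [DecidableEq n]
    (M : Matrix m n ℝ) (i : m) (j : n) : |M i j| ≤ specNorm M := by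
  have h := (LinearMap.toContinuousLinearMap (Matrix.toEuclideanLin M)).le_opNorm
    (EuclideanSpace.single j 1)
  have h' := PiLp.norm_apply_le
    (LinearMap.toContinuousLinearMap (Matrix.toEuclideanLin M) (EuclideanSpace.single j 1)) i
  simpa [specNorm, Matrix.toLpLin_apply] using h'.trans h

/-- Translation by `s` on `ℓ²(ℤ; ℝ^p)`. -/
def shiftBy (p : ℕ) (s : ℤ) : Hp p →ₗᵢ[ℝ] Hp p where
  toFun f := ⟨fun t => f (t - s), memℓp_gen <|
    ((lp.memℓp f).summable (by simp)).comp_injective (sub_left_injective (b := s))⟩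
  map_add' _ _ := rfl
  map_smul' _ _ := rfl
  norm_map' f := by
    refine Real.rpow_left_injOn (x := (2 : ENNReal).toReal) (by simp)
      (norm_nonneg _) (norm_nonneg _) ?_
    simp only [lp.norm_rpow_eq_tsum (p := 2) (by simp)]
    exact (Equiv.subRight s).tsum_eq fun t => ‖f t‖ ^ (2 : ENNReal).toReal

lemma shiftBy_bvec (p : ℕ) (s t : ℤ) (a : Fin p) :
    shiftBy p s (bvec p t a) = bvec p (t + s) a := by
  ext r : 2
  change (lp.single 2 t (EuclideanSpace.single a 1) : Hp p) (r - s) =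
    (lp.single 2 (t + s) (EuclideanSpace.single a 1) : Hp p) r
  simp only [lp.single_apply, Pi.single_apply, sub_eq_iff_eq_add]

lemma inner_adjoint_comp_comp_shiftBy {p : ℕ} (A : Hp p →L[ℝ] Hp p) (s : ℤ) (x y : Hp p) :
    inner ℝ x ((ContinuousLinearMap.adjoint (shiftBy p s).toContinuousLinearMap ∘L A ∘L
      (shiftBy p s).toContinuousLinearMap) y) =
      inner ℝ (shiftBy p s x) (A (shiftBy p s y)) := by
  simp [ContinuousLinearMap.adjoint_inner_right]

lemma tendsto_int_floor_mul_add_div (u : ℝ) (t : ℤ) :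
    Tendsto (fun N : ℕ => ((t + ⌊u * N⌋ : ℤ) : ℝ) / N) atTop (𝓝 u) := by
  have h1 : Tendsto (fun N : ℕ => u + ((t : ℝ) - 1) / N) atTop (𝓝 u) := by
    simpa using (tendsto_const_div_atTop_nhds_zero_nat ((t : ℝ) - 1)).const_add u
  have h2 : Tendsto (fun N : ℕ => u + (t : ℝ) / N) atTop (𝓝 u) := by
    simpa using (tendsto_const_div_atTop_nhds_zero_nat (t : ℝ)).const_add u
  refine tendsto_of_tendsto_of_tendsto_of_le_of_le' h1 h2 ?_ ?_ <;>
    filter_upwards [eventually_gt_atTop 0] with N hN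
  · have : (0 : ℝ) < N := by exact_mod_cast hN
    rw [le_div_iff₀ this, add_mul, div_mul_cancel₀ _ this.ne']
    push_cast
    linarith [Int.lt_floor_add_one (u * N)]
  · have : (0 : ℝ) < N := by exact_mod_cast hN
    rw [div_le_iff₀ this, add_mul, div_mul_cancel₀ _ this.ne']
    push_cast
    linarith [Int.floor_le (u * N)]

/-- The blocks of `𝐂^(N)` at positions translated by `⌊uN⌋` converge to the local
autocovariance at `u`. -/
lemma AssumptionLS.tendsto_blk {p : ℕ} {K κ lamInf lamSup : ℝ} {N₀ : ℕ}
    {C : ℕ → Hp p →L[ℝ] Hp p} {Cr : ℤ → ℝ → Matrix (Fin p) (Fin p) ℝ}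
    (hLS : AssumptionLS p K κ lamInf lamSup N₀ C Cr) (u : ℝ) (t τ : ℤ) (a b : Fin p) :
    Tendsto (fun N : ℕ => blk (C N) (t + ⌊u * N⌋) (τ + ⌊u * N⌋) a b) atTop
      (𝓝 (Cr (t - τ) u a b)) := by
  have hlip : Tendsto (fun N : ℕ => Cr (t - τ) (((t + ⌊u * N⌋ : ℤ) : ℝ) / N) a b) atTop
      (𝓝 (Cr (t - τ) u a b)) := by
    rw [tendsto_iff_dist_tendsto_zero]
    have hz : Tendsto (fun N : ℕ => K * |((t + ⌊u * N⌋ : ℤ) : ℝ) / N - u| *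
        gu ((t - τ : ℤ) : ℝ) ^ (-κ)) atTop (𝓝 0) := by
      simpa using ((((tendsto_int_floor_mul_add_div u t).sub_const u).abs.const_mul K).mul_const
        (gu ((t - τ : ℤ) : ℝ) ^ (-κ)))
    refine squeeze_zero (fun _ => dist_nonneg) (fun N => ?_) hz
    exact (abs_entry_le_specNorm (Cr (t - τ) _ - Cr (t - τ) u) a b).trans (hLS.crLip _ _ _)
  have happrox : Tendsto (fun N : ℕ => blk (C N) (t + ⌊u * N⌋) (τ + ⌊u * N⌋) a b -
      Cr (t - τ) (((t + ⌊u * N⌋ : ℤ) : ℝ) / N) a b) atTop (𝓝 0) := by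
    have hz : Tendsto (fun N : ℕ => K * gu ((t : ℝ) - τ) ^ (-κ + 1) *
        min (1 / (N : ℝ)) (2 / gu ((t : ℝ) - τ))) atTop (𝓝 0) := by
      have hpos : 0 ≤ 2 / gu ((t : ℝ) - τ) :=
        div_nonneg zero_le_two (zero_le_one.trans (le_max_left _ _))
      simpa [min_eq_left hpos] using ((tendsto_one_div_atTop_nhds_zero_nat (𝕜 := ℝ)).min
        (tendsto_const_nhds (x := 2 / gu ((t : ℝ) - τ)))).const_mul
          (K * gu ((t : ℝ) - τ) ^ (-κ + 1))
    refine squeeze_zero_norm' ?_ hz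
    filter_upwards [eventually_ge_atTop 1] with N hN
    have h := (abs_entry_le_specNorm _ a b).trans
      (hLS.approx N hN (t + ⌊u * N⌋) (τ + ⌊u * N⌋))
    simpa using h
  simpa using happrox.add hlip

/-- Theorem 3.1: positive definiteness of the local approximating covariance.  For every
`u` the block Toeplitz operator `𝐂(u)` (with blocks `C_{t−τ}(u)`) exists as a bounded
self-adjoint operator whose quadratic form is bounded between `λ_inf` and `λ_sup`. -/
theorem local_covariance_positive_definite (K κ lamInf lamSup : ℝ) (N₀ : ℕ)
    (hκ : 3 < κ) (hInf : 0 < lamInf) (hle : lamInf ≤ lamSup)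
    (p : ℕ) (hp : 1 ≤ p)
    (C : ℕ → Hp p →L[ℝ] Hp p) (Cr : ℤ → ℝ → Matrix (Fin p) (Fin p) ℝ)
    (hLS : AssumptionLS p K κ lamInf lamSup N₀ C Cr) :
    ∀ u : ℝ, ∃ CU : Hp p →L[ℝ] Hp p,
      (∀ t τ : ℤ, blk CU t τ = Cr (t - τ) u) ∧
      (∀ x y : Hp p, inner (𝕜 := ℝ) (CU x) y = inner (𝕜 := ℝ) x (CU y)) ∧
      (∀ v : Hp p,
        lamInf * ‖v‖ ^ 2 ≤ inner (𝕜 := ℝ) v (CU v) ∧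
        inner (𝕜 := ℝ) v (CU v) ≤ lamSup * ‖v‖ ^ 2) := by
  intro u
  have hSup : 0 ≤ lamSup := hInf.le.trans hle
  let A (N : ℕ) : Hp p →L[ℝ] Hp p :=
    ContinuousLinearMap.adjoint (shiftBy p ⌊u * N⌋).toContinuousLinearMap ∘L C N ∘L
      (shiftBy p ⌊u * N⌋).toContinuousLinearMap
  have hA (N : ℕ) (x y : Hp p) : inner ℝ x (A N y) =
      inner ℝ (shiftBy p ⌊u * N⌋ x) (C N (shiftBy p ⌊u * N⌋ y)) :=
    inner_adjoint_comp_comp_shiftBy (C N) _ x y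
  have hsymm (N : ℕ) (x y : Hp p) : inner ℝ x (A N y) = inner ℝ y (A N x) := by
    rw [hA, hA, ← hLS.symm, real_inner_comm]
  have hlow (N : ℕ) (hN : N₀ ≤ N) (v : Hp p) : lamInf * ‖v‖ ^ 2 ≤ inner ℝ v (A N v) := by
    simpa [hA] using hLS.lower N hN (shiftBy p ⌊u * N⌋ v)
  have hupp (N : ℕ) (hN : N₀ ≤ N) (v : Hp p) : inner ℝ v (A N v) ≤ lamSup * ‖v‖ ^ 2 := by
    simpa [hA] using hLS.upper N hN (shiftBy p ⌊u * N⌋ v)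
  have hU : (hyperfilter ℕ : Filter ℕ) ≤ atTop := Nat.hyperfilter_le_atTop
  have hN₀ : ∀ᶠ N in (hyperfilter ℕ : Filter ℕ), N₀ ≤ N := hU (eventually_ge_atTop N₀)
  obtain ⟨CU, hCU⟩ := ContinuousLinearMap.exists_tendsto_inner_of_eventually_norm_le
    (hyperfilter ℕ) A lamSup (by
      filter_upwards [hN₀] with N hN
      exact ContinuousLinearMap.norm_le_of_inner_self_le hSup
        (fun x y => (real_inner_comm _ _).trans (hsymm N y x))
        (fun v => (by positivity : 0 ≤ lamInf * ‖v‖ ^ 2).trans (hlow N hN v)) (hupp N hN))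
  refine ⟨CU, fun t τ => ?_, fun x y => ?_, fun v => ⟨?_, ?_⟩⟩
  · ext a b
    refine tendsto_nhds_unique (hCU (bvec p t a) (bvec p τ b)) ?_
    simp only [hA, shiftBy_bvec]
    exact (hLS.tendsto_blk u t τ a b).mono_left hU
  · rw [real_inner_comm]
    exact tendsto_nhds_unique (hCU y x) ((hCU x y).congr fun N => hsymm N x y)
  · exact ge_of_tendsto (hCU v v) (hN₀.mono fun N hN => hlow N hN v)
  · exact le_of_tendsto (hCU v v) (hN₀.mono fun N hN => hupp N hN v)
end
end

section
/- Lipschitz continuity of the inverse Toeplitz blocks (Theorem 3.4, bound (3.3)). Fix K < ∞, κ > 3, 0 < λ_inf ≤ λ_sup < ∞ and N₀ ∈ ℕ. There exists a constant 𝒦 < ∞, depending only on K, κ, λ_inf, λ_sup, such that whenever Assumption LS(p, K, κ, λ_inf, λ_sup, N₀) holds: for every u ∈ ℝ the operator 𝐂(u) is boundedly invertible, and, writing 𝐃(u) = 𝐂(u)⁻¹ with Toeplitz blocks (𝐃(u))_{t,τ} = D_{t−τ}(u), one has ‖D_r(u) − D_r(v)‖₂ ≤ 𝒦 |u − v| ζ(r)^{κ−1}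 for all u, v ∈ ℝ and r ∈ ℤ. -/
noncomputable section

open Filter Topology

namespace BlockToeplitz

/-- The fibre `ℝ^p`. -/
abbrev Fib (p : ℕ) : Type := EuclideanSpace ℝ (Fin p)

/-- A `p × p` matrix as a continuous linear map of `ℝ^p`. -/
def matCLM {p : ℕ} (M : Matrix (Fin p) (Fin p) ℝ) : Fib p →L[ℝ] Fib p :=
  LinearMap.toContinuousLinearMap (Matrix.toEuclideanLin M)

lemma specNorm_eq {p : ℕ} (M : Matrix (Fin p) (Fin p) ℝ) : specNorm M = ‖matCLM M‖ := rfl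

lemma matCLM_sub {p : ℕ} (M N : Matrix (Fin p) (Fin p) ℝ) :
    matCLM (M - N) = matCLM M - matCLM N := by
  simp [matCLM]

/-- The single-fibre embedding into `ℓ²(ℤ; ℝ^p)`. -/
abbrev sgl {p : ℕ} (t : ℤ) (x : Fib p) : Hp p := lp.single 2 t x

lemma inner_bvec_left {p : ℕ} (t : ℤ) (a : Fin p) (x : Hp p) :
    inner ℝ (bvec p t a) x = x t a := by
  rw [bvec, lp.inner_single_left, EuclideanSpace.inner_single_left]
  simp

/-- The block `A_{t,τ}` as a continuous linear map. -/
lemma matCLM_blk {p : ℕ} (A : Hp p →L[ℝ] Hp p) (t τ : ℤ) :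
    matCLM (blk A t τ) = (lp.evalCLM ℝ (fun _ : ℤ => Fib p) 2 t).comp
      (A.comp (lp.singleContinuousLinearMap ℝ (fun _ : ℤ => Fib p) 2 τ)) := by
  apply ContinuousLinearMap.coe_injective
  refine (EuclideanSpace.basisFun (Fin p) ℝ).toBasis.ext fun b => ?_
  ext a
  simp [matCLM, Matrix.toLpLin_apply, blk, inner_bvec_left]
  rfl

lemma matCLM_blk_apply {p : ℕ} (A : Hp p →L[ℝ] Hp p) (t τ : ℤ) (x : Fib p) :
    matCLM (blk A t τ) x = A (sgl τ x) t := by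
  rw [matCLM_blk]; rfl

lemma specNorm_blk_le {p : ℕ} (A : Hp p →L[ℝ] Hp p) (t τ : ℤ) : specNorm (blk A t τ) ≤ ‖A‖ := by
  rw [specNorm_eq]
  refine ContinuousLinearMap.opNorm_le_bound _ (norm_nonneg _) fun x => ?_
  rw [matCLM_blk_apply]
  refine (lp.norm_apply_le_norm two_ne_zero _ _).trans ((A.le_opNorm _).trans_eq ?_)
  rw [lp.norm_single two_pos]

lemma blk_sub {p : ℕ} (A B : Hp p →L[ℝ] Hp p) (t τ : ℤ) :
    blk (A - B) t τ = blk A t τ - blk B t τ := by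
  ext a b
  simp [blk, inner_sub_right]

lemma ext_blk {p : ℕ} {A B : Hp p →L[ℝ] Hp p}
    (h : ∀ t τ x, A (sgl τ x) t = B (sgl τ x) t) : A = B := by
  refine lp.ext_continuousLinearMap (𝕜 := ℝ) ENNReal.ofNat_ne_top fun τ => ?_
  ext1 x
  refine lp.ext (funext fun t => ?_)
  exact h t τ x

section Shift

lemma norm_sq_eq_tsum {p : ℕ} (x : Hp p) : ‖x‖ ^ 2 = ∑' t, ‖x t‖ ^ 2 := by
  simpa using lp.norm_rpow_eq_tsum (p := 2) (by simp) x

lemma summable_norm_sq {p : ℕ} (x : Hp p) : Summable fun t => ‖x t‖ ^ 2 := by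
  simpa using (memℓp_gen_iff (p := 2) (by simp)).1 (lp.memℓp x)

/-- The translation `x ↦ x(· - s)`. -/
def shift (p : ℕ) (s : ℤ) : Hp p →ₗᵢ[ℝ] Hp p where
  toFun x := ⟨fun t => x (t - s), memℓp_gen (by
    simp only [ENNReal.toReal_ofNat, Real.rpow_ofNat]
    exact (summable_norm_sq x).comp_injective (sub_left_injective (b := s)))⟩
  map_add' _ _ := rfl
  map_smul' _ _ := rfl
  norm_map' x := by
    rw [← sq_eq_sq₀ (norm_nonneg _) (norm_nonneg _), norm_sq_eq_tsum, norm_sq_eq_tsum]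
    exact (Equiv.subRight s).tsum_eq fun t => ‖x t‖ ^ 2

/-- The fibrewise action of a continuous linear map. -/
def diag {p : ℕ} (M : Fib p →L[ℝ] Fib p) : Hp p →L[ℝ] Hp p :=
  LinearMap.mkContinuous
    { toFun := fun x => ⟨fun t => M (x t), memℓp_gen (by
        simp only [ENNReal.toReal_ofNat, Real.rpow_ofNat]
        refine Summable.of_nonneg_of_le (fun _ => by positivity) (fun t => ?_)
          ((summable_norm_sq x).mul_left (‖M‖ ^ 2))
        rw [← mul_pow]
        gcongr
        exact M.le_opNorm _)⟩
      map_add' := fun x y => lp.ext (funext fun t => map_add M (x t) (y t))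
      map_smul' := fun c x => lp.ext (funext fun t => map_smul M c (x t)) }
    ‖M‖ fun x => by
      rw [← sq_le_sq₀ (norm_nonneg _) (by positivity), mul_pow, norm_sq_eq_tsum, norm_sq_eq_tsum,
        ← tsum_mul_left]
      refine Summable.tsum_le_tsum (fun t => ?_) (summable_norm_sq _)
        ((summable_norm_sq x).mul_left _)
      rw [← mul_pow]
      gcongr
      exact M.le_opNorm _

/-- The operator `x ↦ (t ↦ M x(t - s))`, whose blocks vanish off the `s`-th diagonal. -/
def offDiag {p : ℕ} (M : Fib p →L[ℝ] Fib p) (s : ℤ) : Hp p →L[ℝ] Hp p :=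
  (diag M).comp (shift p s).toContinuousLinearMap

lemma offDiag_apply {p : ℕ} (M : Fib p →L[ℝ] Fib p) (s : ℤ) (x : Hp p) (t : ℤ) :
    offDiag M s x t = M (x (t - s)) := rfl

lemma norm_offDiag_le {p : ℕ} (M : Fib p →L[ℝ] Fib p) (s : ℤ) : ‖offDiag M s‖ ≤ ‖M‖ := by
  refine ContinuousLinearMap.opNorm_le_bound _ (norm_nonneg _) fun x => ?_
  rw [offDiag, ContinuousLinearMap.comp_apply]
  refine (ContinuousLinearMap.le_of_opNorm_le _
    (LinearMap.mkContinuous_norm_le _ (norm_nonneg _) _) _).trans_eq ?_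
  congr 1
  exact (shift p s).norm_map x

end Shift

/-- `T` has bandwidth `w`: `(T x)(t)` only depends on the `x(s)` with `|t - s| ≤ w`. -/
def Banded {p : ℕ} (w : ℕ) (T : Hp p →L[ℝ] Hp p) : Prop :=
  ∀ (x : Hp p) (t : ℤ), (∀ s, |t - s| ≤ w → x s = 0) → T x t = 0

namespace Banded

variable {p : ℕ} {v w : ℕ} {S T : Hp p →L[ℝ] Hp p}

lemma mono (hT : Banded v T) (h : v ≤ w) : Banded w T := fun x t hx =>
  hT x t fun s hs => hx s (hs.trans (by exact_mod_cast h))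

lemma one : Banded w (1 : Hp p →L[ℝ] Hp p) := fun x t hx => hx t (by simp)

lemma zero : Banded w (0 : Hp p →L[ℝ] Hp p) := fun _ _ _ => rfl

lemma add (hS : Banded w S) (hT : Banded w T) : Banded w (S + T) := fun x t hx => by
  change S x t + T x t = 0
  rw [hS x t hx, hT x t hx, add_zero]

lemma smul (c : ℝ) (hT : Banded w T) : Banded w (c • T) := fun x t hx => by
  change c • T x t = 0
  rw [hT x t hx, smul_zero]

lemma sub (hS : Banded w S) (hT : Banded w T) : Banded w (S - T) := fun x t hx => by
  change S x t - T x t = 0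
  rw [hS x t hx, hT x t hx, sub_zero]

lemma mul (hS : Banded v S) (hT : Banded w T) : Banded (v + w) (S * T) := fun x t hx =>
  hS _ t fun s hs => hT x s fun r hr => hx r <| by
    have := abs_sub_le t s r
    push_cast
    linarith

lemma sum {ι : Type*} (F : Finset ι) {f : ι → Hp p →L[ℝ] Hp p} (h : ∀ i ∈ F, Banded w (f i)) :
    Banded w (∑ i ∈ F, f i) :=
  Finset.sum_induction _ _ (fun _ _ => add) zero h

lemma pow (hT : Banded w T) (n : ℕ) : Banded (n * w) (T ^ n) := by
  induction n with
  | zero => rw [pow_zero]; exact one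
  | succ n ih => rw [pow_succ, add_mul, one_mul]; exact ih.mul hT

lemma offDiag (M : Fib p →L[ℝ] Fib p) {s : ℤ} (hs : |s| ≤ w) :
    Banded w (offDiag M s) := fun x t hx => by
  rw [offDiag_apply, hx (t - s) (by simpa using hs), map_zero]

lemma blk_eq_zero (hT : Banded w T) {t τ : ℤ} (h : w < |t - τ|) : blk T t τ = 0 := by
  ext a b
  simp only [blk, Matrix.of_apply, inner_bvec_left, Matrix.zero_apply]
  rw [hT _ t fun s hs => ?_]
  · rfl
  · refine lp.single_apply_ne _ _ _ ?_
    rintro rfl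
    exact absurd hs (not_le.2 h)

end Banded

section Weights

lemma one_le_gu (x : ℝ) : 1 ≤ gu x := le_max_left _ _

lemma gu_pos (x : ℝ) : 0 < gu x := one_pos.trans_le (one_le_gu x)

lemma gu_rpow_nonneg (x κ : ℝ) : 0 ≤ gu x ^ κ := (Real.rpow_pos_of_pos (gu_pos x) _).le

lemma gu_rpow_le_one (x : ℝ) {κ : ℝ} (hκ : κ ≤ 0) : gu x ^ κ ≤ 1 :=
  Real.rpow_le_one_of_one_le_of_nonpos (one_le_gu x) hκ

lemma gu_natCast_succ (n : ℕ) : gu ((n : ℝ) + 1) = n + 1 := by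
  have : (0 : ℝ) ≤ n := n.cast_nonneg
  rw [gu, abs_of_nonneg (by positivity), max_eq_right (by linarith)]

/-- The summand `⟨s⟩^{-κ}` restricted to `|s| > m`. -/
def tailWt (κ : ℝ) (m : ℕ) (s : ℤ) : ℝ := if (m : ℤ) < |s| then gu (s : ℝ) ^ (-κ) else 0

lemma tailWt_nonneg (κ : ℝ) (m : ℕ) (s : ℤ) : 0 ≤ tailWt κ m s := by
  unfold tailWt
  split_ifs
  exacts [gu_rpow_nonneg _ _, le_rfl]

/-- Discrete comparison of `y^{-(a+1)}` with the integral of `x^{-(a+1)}` over `[y - 1, y]`. -/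
lemma rpow_neg_le_telescope {a y : ℝ} (ha : 0 < a) (hy : 1 < y) :
    y ^ (-(a + 1)) ≤ ((y - 1) ^ (-a) - y ^ (-a)) / a := by
  have hy0 : 0 < y := by linarith
  have hy1 : 0 < y - 1 := by linarith
  have hq : 0 < (y - 1) / y := by positivity
  have h1 : (y - 1) ^ (-a) = y ^ (-a) * ((y - 1) / y) ^ (-a) := by
    rw [← Real.mul_rpow hy0.le hq.le, mul_div_cancel₀ _ hy0.ne']
  have h2 : 1 + a / y ≤ ((y - 1) / y) ^ (-a) := by
    rw [Real.rpow_def_of_pos hq]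
    have hl : Real.log ((y - 1) / y) ≤ -(1 / y) := by
      refine (Real.log_le_sub_one_of_pos hq).trans_eq ?_
      field_simp
      ring
    have := Real.add_one_le_exp (Real.log ((y - 1) / y) * -a)
    have h3 : a / y ≤ Real.log ((y - 1) / y) * -a := by
      have := mul_le_mul_of_nonneg_left hl ha.le
      rw [div_eq_mul_one_div]
      linarith
    linarith
  have h4 : y ^ (-(a + 1)) = y ^ (-a) * (1 / y) := by
    rw [neg_add, Real.rpow_add hy0, Real.rpow_neg_one, one_div]
  have h5 : 0 < y ^ (-a) := Real.rpow_pos_of_pos hy0 _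
  rw [le_div_iff₀ ha, h1, h4]
  have := mul_le_mul_of_nonneg_left h2 h5.le
  calc y ^ (-a) * (1 / y) * a = y ^ (-a) * (1 + a / y) - y ^ (-a) := by ring
    _ ≤ _ := by linarith

lemma sum_tailWt_le {κ : ℝ} (hκ : 1 < κ) {m : ℕ} (hm : 1 ≤ m) (n : ℕ) :
    ∑ i ∈ Finset.range n, tailWt κ m i ≤ (m : ℝ) ^ (-(κ - 1)) / (κ - 1) := by
  have ha : 0 < κ - 1 := by linarith
  set g : ℕ → ℝ := fun i => ((max m i : ℕ) : ℝ) ^ (-(κ - 1)) / (κ - 1) with hg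
  have hstep : ∀ i : ℕ, tailWt κ m ((i + 1 : ℕ) : ℤ) ≤ g i - g (i + 1) := by
    intro i
    unfold tailWt
    rw [Nat.abs_cast]
    split_ifs with h
    · have hmi : m ≤ i := by
        have : m < i + 1 := by exact_mod_cast h
        omega
      have hi : (1 : ℝ) ≤ i := by exact_mod_cast hm.trans hmi
      simp only [hg, max_eq_right hmi, max_eq_right (hmi.trans i.le_succ)]
      have := rpow_neg_le_telescope ha (y := (i : ℝ) + 1) (by linarith)
      push_cast
      rw [gu_natCast_succ, ← sub_div]
      simpa using this
    · have hmi : i + 1 ≤ m := by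
        have : ¬ m < i + 1 := by exact_mod_cast h
        omega
      simp only [hg, max_eq_left hmi, max_eq_left (i.le_succ.trans hmi), sub_self, le_refl]
  have hpos : ∀ i, 0 ≤ g i := fun i => by positivity
  cases n with
  | zero => simpa [hg] using hpos 0
  | succ n =>
    have h0 : tailWt κ m ((0 : ℕ) : ℤ) = 0 := by simp [tailWt]
    rw [Finset.sum_range_succ', h0, add_zero]
    refine (Finset.sum_le_sum fun i _ => hstep i).trans ?_
    rw [Finset.sum_range_sub']
    have : g 0 = (m : ℝ) ^ (-(κ - 1)) / (κ - 1) := by simp [hg]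
    linarith [hpos n]

lemma summable_tailWt_and_tsum_le {κ : ℝ} (hκ : 1 < κ) {m : ℕ} (hm : 1 ≤ m) :
    Summable (tailWt κ m) ∧ ∑' s, tailWt κ m s ≤ 2 * ((m : ℝ) ^ (-(κ - 1)) / (κ - 1)) := by
  have hs : Summable fun n : ℕ => tailWt κ m n :=
    summable_of_sum_range_le (fun _ => tailWt_nonneg _ _ _) (sum_tailWt_le hκ hm)
  have hle : ∑' n : ℕ, tailWt κ m n ≤ _ :=
    Real.tsum_le_of_sum_range_le (fun _ => tailWt_nonneg _ _ _) (sum_tailWt_le hκ hm)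
  have hneg : ∀ n : ℕ, tailWt κ m (-n) = tailWt κ m n := fun n => by simp [tailWt, gu]
  have := HasSum.of_nat_of_neg hs.hasSum (by simpa only [hneg] using hs.hasSum)
  refine ⟨this.summable, ?_⟩
  rw [this.tsum_eq]
  have h0 : tailWt κ m 0 = 0 := by simp [tailWt]
  rw [h0]
  linarith

lemma summable_gu {κ : ℝ} (hκ : 1 < κ) : Summable fun s : ℤ => gu (s : ℝ) ^ (-κ) := by
  refine (summable_tailWt_and_tsum_le hκ le_rfl).1.congr_cofinite ?_
  refine (Set.finite_Icc (-1 : ℤ) 1).subset fun s hs => ?_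
  by_contra hc
  refine hs (if_pos ?_)
  rw [Set.mem_Icc, ← abs_le] at hc
  simpa using hc

end Weights

/-- The total weight `∑ ⟨s⟩^{-κ}`. -/
def totalWt (κ : ℝ) : ℝ := ∑' s : ℤ, gu (s : ℝ) ^ (-κ)

lemma totalWt_nonneg (κ : ℝ) : 0 ≤ totalWt κ := tsum_nonneg fun _ => gu_rpow_nonneg _ _

section Toeplitz

variable {p : ℕ} {κ c : ℝ} {T : Hp p →L[ℝ] Hp p} {M : ℤ → Matrix (Fin p) (Fin p) ℝ}

lemma hasSum_coord {f : ℤ → Hp p →L[ℝ] Hp p} {S : Hp p →L[ℝ] Hp p} (h : HasSum f S) (x : Hp p)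
    (t : ℤ) : HasSum (fun s => f s x t) (S x t) := by
  have h1 : HasSum (fun s => f s x) (S x) :=
    (ContinuousLinearMap.apply ℝ (Hp p) x).hasSum h
  exact (lp.evalCLM ℝ (fun _ : ℤ => Fib p) 2 t).hasSum h1

lemma hasSum_offDiag_apply (hT : ∀ t τ, blk T t τ = M (t - τ)) (t τ : ℤ) (x : Fib p) :
    HasSum (fun s => offDiag (matCLM (M s)) s (sgl τ x) t) (T (sgl τ x) t) := by
  have h2 : T (sgl τ x) t = offDiag (matCLM (M (t - τ))) (t - τ) (sgl τ x) t := by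
    rw [offDiag_apply, ← matCLM_blk_apply, hT, sub_sub_cancel, sgl, lp.single_apply_self]
  rw [h2]
  refine hasSum_single (t - τ) fun s hs => ?_
  rw [offDiag_apply, sgl, lp.single_apply_ne, map_zero]
  omega

lemma hasSum_offDiag (hκ : 1 < κ) (hT : ∀ t τ, blk T t τ = M (t - τ))
    (hM : ∀ s : ℤ, specNorm (M s) ≤ c * gu (s : ℝ) ^ (-κ)) :
    HasSum (fun s => offDiag (matCLM (M s)) s) T := by
  have hs : Summable fun s => offDiag (matCLM (M s)) s :=
    Summable.of_norm_bounded ((summable_gu hκ).mul_left c)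
      fun s => (norm_offDiag_le _ _).trans (hM s)
  have : T = ∑' s, offDiag (matCLM (M s)) s :=
    ext_blk fun t τ x => (hasSum_offDiag_apply hT t τ x).unique (hasSum_coord hs.hasSum _ t)
  rw [this]
  exact hs.hasSum

lemma norm_toeplitz_le (hκ : 1 < κ) (hT : ∀ t τ, blk T t τ = M (t - τ))
    (hM : ∀ s : ℤ, specNorm (M s) ≤ c * gu (s : ℝ) ^ (-κ)) : ‖T‖ ≤ c * totalWt κ :=
  (hasSum_offDiag hκ hT hM).norm_le_of_bounded ((summable_gu hκ).hasSum.mul_left c)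
    fun s => (norm_offDiag_le _ _).trans (hM s)

lemma exists_banded_approx (hκ : 1 < κ) (hc : 0 ≤ c) (hT : ∀ t τ, blk T t τ = M (t - τ))
    (hM : ∀ s : ℤ, specNorm (M s) ≤ c * gu (s : ℝ) ^ (-κ)) {m : ℕ} (hm : 1 ≤ m) :
    ∃ T' : Hp p →L[ℝ] Hp p, Banded m T' ∧ ‖T'‖ ≤ c * totalWt κ ∧
      ‖T - T'‖ ≤ c * (2 * ((m : ℝ) ^ (-(κ - 1)) / (κ - 1))) := by
  have hf : ∀ s, ‖offDiag (matCLM (M s)) s‖ ≤ c * gu (s : ℝ) ^ (-κ) :=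
    fun s => (norm_offDiag_le _ _).trans (hM s)
  refine ⟨∑ s ∈ Finset.Icc (-m : ℤ) m, offDiag (matCLM (M s)) s, ?_, ?_, ?_⟩
  · exact Banded.sum _ fun s hs => Banded.offDiag _ (abs_le.2 (Finset.mem_Icc.1 hs))
  · refine (norm_sum_le_of_le _ fun s _ => hf s).trans ?_
    rw [← Finset.mul_sum]
    gcongr
    exact (summable_gu hκ).sum_le_tsum _ fun _ _ => gu_rpow_nonneg _ _
  · have h1 := (hasSum_offDiag hκ hT hM).sub
      (hasSum_sum_of_ne_finset_zero (s := Finset.Icc (-m : ℤ) m)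
        (f := fun s => if s ∈ Finset.Icc (-m : ℤ) m then offDiag (matCLM (M s)) s else 0)
        fun s hs => if_neg hs)
    rw [Finset.sum_congr rfl fun s hs => if_pos hs] at h1
    obtain ⟨hs, hle⟩ := summable_tailWt_and_tsum_le hκ hm
    refine (h1.norm_le_of_bounded (hs.hasSum.mul_left c) fun s => ?_).trans (by gcongr)
    unfold tailWt
    by_cases h : (m : ℤ) < |s|
    · rw [if_pos h, if_neg (by rw [Finset.mem_Icc, ← abs_le]; exact not_le.2 h), sub_zero]
      exact hf s
    · rw [if_neg h, if_pos (by rw [Finset.mem_Icc, ← abs_le]; exact not_lt.1 h), sub_self]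
      simp

end Toeplitz

section Coercivity

variable {p : ℕ} {K κ lamInf lamSup : ℝ} {N₀ : ℕ} {C : ℕ → Hp p →L[ℝ] Hp p}
  {Cr : ℤ → ℝ → Matrix (Fin p) (Fin p) ℝ}

lemma inner_sum_sgl (A : Hp p →L[ℝ] Hp p) (F : Finset ℤ) (k : ℤ) (x : ℤ → Fib p) :
    inner ℝ (∑ i ∈ F, sgl (i + k) (x i)) (A (∑ j ∈ F, sgl (j + k) (x j))) =
      ∑ i ∈ F, ∑ j ∈ F, inner ℝ (x i) (matCLM (blk A (i + k) (j + k)) (x j)) := by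
  rw [map_sum, sum_inner]
  refine Finset.sum_congr rfl fun i _ => ?_
  rw [inner_sum]
  refine Finset.sum_congr rfl fun j _ => ?_
  rw [lp.inner_single_left, matCLM_blk_apply]

lemma norm_sq_sum_sgl (F : Finset ℤ) (k : ℤ) (x : ℤ → Fib p) :
    ‖∑ i ∈ F, sgl (i + k) (x i)‖ ^ 2 = ∑ i ∈ F, ‖x i‖ ^ 2 := by
  have h := lp.norm_sum_single (p := 2) (by simp) (fun i => x (i - k))
    (F.map (Equiv.addRight k).toEmbedding)
  simpa using h

/-- Translating `𝐂^(N)` by `⌊N u⌋` turns its blocks into those of the local Toeplitz operator. -/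
lemma tendsto_blk (h : AssumptionLS p K κ lamInf lamSup N₀ C Cr) (hκ : 1 < κ) (u : ℝ) (i j : ℤ) :
    Tendsto (fun N : ℕ => matCLM (blk (C N) (i + ⌊N * u⌋) (j + ⌊N * u⌋))) atTop
      (𝓝 (matCLM (Cr (i - j) u))) := by
  rw [tendsto_iff_norm_sub_tendsto_zero]
  have hlim : Tendsto (fun N : ℕ => |K| * (|(i : ℝ)| + 2) * (N : ℝ)⁻¹) atTop (𝓝 0) := by
    simpa using tendsto_natCast_atTop_atTop.inv_tendsto_atTop.const_mul (|K| * (|(i : ℝ)| + 2))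
  refine squeeze_zero' (Eventually.of_forall fun _ => norm_nonneg _) ?_ hlim
  filter_upwards [eventually_ge_atTop 1] with N hN
  have hN0 : (0 : ℝ) < N := by exact_mod_cast hN
  set k := ⌊N * u⌋ with hk
  have h1 := h.approx N hN (i + k) (j + k)
  rw [add_sub_add_right_eq_sub] at h1
  have h2 := h.crLip (i - j) (((i + k : ℤ) : ℝ) / N) u
  rw [specNorm_eq, matCLM_sub] at h1 h2
  have hfl : |((i + k : ℤ) : ℝ) / N - u| ≤ (|(i : ℝ)| + 1) / N := by
    have e : ((i + k : ℤ) : ℝ) / N - u = (i + (k - N * u)) / N := by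
      push_cast
      field_simp
      ring
    rw [e, abs_div, abs_of_pos hN0]
    gcongr
    refine (abs_add_le _ _).trans ?_
    gcongr
    have := Int.floor_le (N * u)
    have := Int.lt_floor_add_one (N * u)
    rw [abs_le]
    constructor <;> linarith
  have h3 : ∀ y : ℝ, K * gu y ^ (-κ + 1) * min (1 / (N : ℝ)) (2 / gu y) ≤ |K| * (1 / N) := by
    intro y
    have hg : 0 ≤ min (1 / (N : ℝ)) (2 / gu y) :=
      le_min (by positivity) (div_nonneg two_pos.le (gu_pos y).le)
    calc K * gu y ^ (-κ + 1) * min (1 / (N : ℝ)) (2 / gu y)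
        ≤ |K| * 1 * min (1 / (N : ℝ)) (2 / gu y) := by
          gcongr
          · exact gu_rpow_nonneg _ _
          · exact le_abs_self K
          · exact gu_rpow_le_one _ (by linarith)
      _ ≤ |K| * (1 / N) := by rw [mul_one]; gcongr; exact min_le_left _ _
  have h4 : K * |((i + k : ℤ) : ℝ) / N - u| * gu ((i - j : ℤ) : ℝ) ^ (-κ) ≤
      |K| * ((|(i : ℝ)| + 1) / N) * 1 := by
    gcongr
    · exact gu_rpow_nonneg _ _
    · exact le_abs_self K
    · exact gu_rpow_le_one _ (by linarith)
  calc ‖matCLM (blk (C N) (i + k) (j + k)) - matCLM (Cr (i - j) u)‖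
      ≤ ‖matCLM (blk (C N) (i + k) (j + k)) - matCLM (Cr (i - j) (((i + k : ℤ) : ℝ) / N))‖ +
        ‖matCLM (Cr (i - j) (((i + k : ℤ) : ℝ) / N)) - matCLM (Cr (i - j) u)‖ :=
        norm_sub_le_norm_sub_add_norm_sub _ _ _
    _ ≤ |K| * (1 / N) + |K| * ((|(i : ℝ)| + 1) / N) * 1 :=
        add_le_add (h1.trans (h3 _)) (h2.trans h4)
    _ = |K| * (|(i : ℝ)| + 2) * (N : ℝ)⁻¹ := by field_simp; ring

/-- The lower spectral bound passes to the local Toeplitz operator. -/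
lemma coercive_of_blk_eq (h : AssumptionLS p K κ lamInf lamSup N₀ C Cr) (hκ : 1 < κ) {u : ℝ}
    {T : Hp p →L[ℝ] Hp p} (hT : ∀ t τ, blk T t τ = Cr (t - τ) u) (x : Hp p) :
    lamInf * ‖x‖ ^ 2 ≤ inner ℝ x (T x) := by
  have hx : Tendsto (fun F : Finset ℤ => ∑ i ∈ F, sgl i (x i)) atTop (𝓝 x) :=
    lp.hasSum_single ENNReal.ofNat_ne_top x
  refine le_of_tendsto_of_tendsto ((hx.norm.pow 2).const_mul lamInf)
    (hx.inner ((T.continuous.tendsto x).comp hx)) (Eventually.of_forall fun F => ?_)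
  have h0 := inner_sum_sgl T F 0 x
  have h1 := norm_sq_sum_sgl F 0 x
  simp only [add_zero, hT] at h0 h1
  simp only [Function.comp_apply]
  rw [h0, h1]
  have hlim : Tendsto (fun N : ℕ => ∑ i ∈ F, ∑ j ∈ F,
      inner ℝ (x i) (matCLM (blk (C N) (i + ⌊N * u⌋) (j + ⌊N * u⌋)) (x j))) atTop
      (𝓝 (∑ i ∈ F, ∑ j ∈ F, inner ℝ (x i) (matCLM (Cr (i - j) u) (x j)))) :=
    tendsto_finsetSum _ fun i _ => tendsto_finsetSum _ fun j _ =>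
      tendsto_const_nhds.inner (((ContinuousLinearMap.apply ℝ (Fib p) (x j)).continuous.tendsto
        _).comp (tendsto_blk h hκ u i j))
  refine ge_of_tendsto hlim ?_
  filter_upwards [eventually_ge_atTop N₀] with N hN
  rw [← inner_sum_sgl, ← norm_sq_sum_sgl F ⌊N * u⌋]
  exact h.lower N hN _

end Coercivity

section Inverse

lemma norm_one_sub_smul_le {H : Type*} [NormedAddCommGroup H] [InnerProductSpace ℝ H]
    {T : H →L[ℝ] H} {lam B : ℝ} (hlam : 0 < lam) (hB : 0 < B) (hle : ‖T‖ ≤ B)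
    (hT : ∀ x, lam * ‖x‖ ^ 2 ≤ inner ℝ x (T x)) :
    ‖1 - (lam / B ^ 2) • T‖ ≤ √(1 - (lam / B) ^ 2) := by
  refine ContinuousLinearMap.opNorm_le_bound _ (Real.sqrt_nonneg _) fun x => ?_
  set β := lam / B ^ 2 with hβ
  have hβ0 : 0 < β := by positivity
  have h1 : ‖(1 - β • T) x‖ ^ 2 ≤ (1 - (lam / B) ^ 2) * ‖x‖ ^ 2 := by
    change ‖x - β • T x‖ ^ 2 ≤ _
    rw [norm_sub_sq_real, inner_smul_right, norm_smul, Real.norm_of_nonneg hβ0.le]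
    have h2 : ‖T x‖ ≤ B * ‖x‖ := T.le_of_opNorm_le hle x
    have h3 : (β * ‖T x‖) ^ 2 ≤ (β * (B * ‖x‖)) ^ 2 := by gcongr
    have h4 := mul_le_mul_of_nonneg_left (hT x) hβ0.le
    have h5 : (β * (B * ‖x‖)) ^ 2 = (lam / B) ^ 2 * ‖x‖ ^ 2 := by rw [hβ]; field_simp
    have h6 : β * (lam * ‖x‖ ^ 2) = (lam / B) ^ 2 * ‖x‖ ^ 2 := by rw [hβ]; field_simp
    linarith
  calc ‖(1 - β • T) x‖ = √(‖(1 - β • T) x‖ ^ 2) := (Real.sqrt_sq (norm_nonneg _)).symm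
    _ ≤ √((1 - (lam / B) ^ 2) * ‖x‖ ^ 2) := Real.sqrt_le_sqrt h1
    _ = √(1 - (lam / B) ^ 2) * ‖x‖ := by
      rw [Real.sqrt_mul' _ (sq_nonneg _), Real.sqrt_sq (norm_nonneg _)]

lemma exists_inverse {R : Type*} [NormedRing R] [NormedAlgebra ℝ R] [CompleteSpace R]
    {T : R} {β : ℝ} (h : ‖1 - β • T‖ < 1) : ∃ D : R, T * D = 1 ∧ D * T = 1 := by
  obtain ⟨U, hU⟩ : ∃ U : Rˣ, (U : R) = β • T := ⟨Units.oneSub _ h, by simp⟩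
  refine ⟨β • (↑U⁻¹ : R), ?_, ?_⟩
  · rw [mul_smul_comm, ← smul_mul_assoc, ← hU, Units.mul_inv]
  · rw [smul_mul_assoc, ← mul_smul_comm, ← hU, Units.inv_mul]

variable {p : ℕ} {T D : Hp p →L[ℝ] Hp p} {β ρ : ℝ}

lemma norm_inverse_le (hβ : 0 < β) (hρ : ρ < 1) (h : ‖1 - β • T‖ ≤ ρ) (hD : D * T = 1) :
    ‖D‖ ≤ β / (1 - ρ) := by
  have e : D = β • 1 + D * (1 - β • T) := by
    rw [mul_sub, mul_one, mul_smul_comm, hD, add_sub_cancel]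
  have h1 : ‖β • (1 : Hp p →L[ℝ] Hp p)‖ ≤ β := by
    rw [norm_smul, Real.norm_of_nonneg hβ.le]
    exact mul_le_of_le_one_right hβ.le ContinuousLinearMap.norm_id_le
  have h2 : ‖D * (1 - β • T)‖ ≤ ‖D‖ * ρ := (norm_mul_le _ _).trans (by gcongr)
  have h3 : ‖D‖ ≤ β + ‖D‖ * ρ := by
    conv_lhs => rw [e]
    exact (norm_add_le _ _).trans (add_le_add h1 h2)
  rw [le_div_iff₀ (by linarith)]
  linarith

lemma norm_pow_le_pow {X : Hp p →L[ℝ] Hp p} (h : ‖X‖ ≤ ρ) (n : ℕ) : ‖X ^ n‖ ≤ ρ ^ n := by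
  have hρ : 0 ≤ ρ := (norm_nonneg _).trans h
  induction n with
  | zero =>
    rw [pow_zero, pow_zero]
    exact ContinuousLinearMap.norm_id_le
  | succ n ih =>
    rw [pow_succ, pow_succ]
    exact (norm_mul_le _ _).trans (by gcongr)

/-- The truncated Neumann series of a banded approximation of `T` approximates `T⁻¹`. -/
lemma exists_banded_approx_inverse (hβ : 0 < β) (hρ : ρ < 1) (h : ‖1 - β • T‖ ≤ ρ)
    (hTD : T * D = 1) (hDT : D * T = 1) {T' : Hp p →L[ℝ] Hp p} {m : ℕ} (hT' : Banded m T') {ε : ℝ}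
    (hε : ‖T - T'‖ ≤ ε) (h' : ‖1 - β • T'‖ ≤ ρ) (n : ℕ) :
    ∃ D' : Hp p →L[ℝ] Hp p, Banded (n * m) D' ∧ ‖D'‖ ≤ β / (1 - ρ) ∧
      ‖D - D'‖ ≤ (ρ ^ n + β / (1 - ρ) * ε) * (β / (1 - ρ)) := by
  have hρ0 : 0 ≤ ρ := (norm_nonneg _).trans h
  have h1ρ : 0 < 1 - ρ := by linarith
  set X := 1 - β • T' with hX
  set D' := β • ∑ k ∈ Finset.range n, X ^ k with hD'
  have hn : ‖D'‖ ≤ β / (1 - ρ) := by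
    rw [hD', norm_smul, Real.norm_of_nonneg hβ.le, div_eq_mul_inv]
    gcongr
    refine (norm_sum_le_of_le _ fun k _ => norm_pow_le_pow h' k).trans ?_
    rw [← tsum_geometric_of_lt_one hρ0 hρ]
    exact (summable_geometric_of_lt_one hρ0 hρ).sum_le_tsum _ fun _ _ => by positivity
  refine ⟨D', ?_, hn, ?_⟩
  · refine (Banded.sum _ fun k hk => ?_).smul _
    refine Banded.mono (((Banded.one.sub (hT'.smul β)).pow k)) ?_
    gcongr
    exact (Finset.mem_range.1 hk).le
  · have e1 : D' * T' = 1 - X ^ n := by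
      rw [← geom_sum_mul_neg, hD', smul_mul_assoc, ← mul_smul_comm, hX, sub_sub_cancel]
    have e2 : D - D' = (X ^ n - D' * (T - T')) * D := by
      rw [mul_sub, e1, sub_mul, sub_mul, mul_assoc, hTD, sub_mul, one_mul, mul_one]
      abel
    rw [e2]
    have h3 : ‖D' * (T - T')‖ ≤ β / (1 - ρ) * ε := (norm_mul_le _ _).trans (by gcongr)
    have h4 := (norm_sub_le _ _).trans (add_le_add (norm_pow_le_pow h' n) h3)
    exact (norm_mul_le _ _).trans (mul_le_mul h4 (norm_inverse_le hβ hρ h hDT) (norm_nonneg _)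
      ((norm_nonneg _).trans h4))

end Inverse

section Difference

/-- Lipschitz constant in the block bound for differences of inverse Toeplitz operators whose
symbols are bounded by `K ⟨s⟩^{-κ}`, in terms of a contraction rate `ρ` for `1 - β T`. -/
def diffConst (κ K β ρ : ℝ) : ℝ :=
  let G := β / (1 - (1 + ρ) / 2)
  let Z := totalWt κ
  K * (2 * Z * G ^ 2 + (2 * Z * G ^ 3 * K + G ^ 2) * (2 / (κ - 1)) +
    G ^ 2 * Z * (β * K * (2 / (κ - 1)) / ((1 - ρ) / 2)))

variable {p : ℕ} {κ K β ρ δ : ℝ} {Tu Tv Du Dv : Hp p →L[ℝ] Hp p}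
  {Mu Mv : ℤ → Matrix (Fin p) (Fin p) ℝ}

lemma norm_inverse_sub_le (hκ : 1 < κ) (hβ : 0 < β) (hρ : ρ < 1)
    (hu : ‖1 - β • Tu‖ ≤ ρ) (hv : ‖1 - β • Tv‖ ≤ ρ) (hDu : Du * Tu = 1) (hDv : Dv * Tv = 1)
    (hDv' : Tv * Dv = 1)
    (hTu : ∀ t τ, blk Tu t τ = Mu (t - τ)) (hTv : ∀ t τ, blk Tv t τ = Mv (t - τ))
    (hM : ∀ s : ℤ, specNorm (Mv s - Mu s) ≤ K * δ * gu (s : ℝ) ^ (-κ)) :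
    ‖Du - Dv‖ ≤ K * δ * (totalWt κ * (β / (1 - ρ)) ^ 2) := by
  have e : Du - Dv = Du * (Tv - Tu) * Dv := by
    rw [mul_sub, sub_mul, mul_assoc, hDv', hDu, mul_one, one_mul]
  have h1 : ‖Tv - Tu‖ ≤ K * δ * totalWt κ :=
    norm_toeplitz_le (M := fun s => Mv s - Mu s) hκ (fun t τ => by rw [blk_sub, hTu, hTv]) hM
  have hG : 0 ≤ β / (1 - ρ) := div_nonneg hβ.le (by linarith)
  rw [e]
  calc ‖Du * (Tv - Tu) * Dv‖ ≤ ‖Du‖ * ‖Tv - Tu‖ * ‖Dv‖ := norm_mul₃_le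
    _ ≤ β / (1 - ρ) * (K * δ * totalWt κ) * (β / (1 - ρ)) := by
      gcongr
      · exact mul_nonneg hG ((norm_nonneg _).trans h1)
      · exact norm_inverse_le hβ hρ hu hDu
      · exact norm_inverse_le hβ hρ hv hDv
    _ = _ := by ring

lemma norm_blk_inverse_sub_le_of_banded (hκ : 1 < κ) (hβ : 0 < β) (hρ : ρ < 1) (hK : 0 ≤ K)
    (hδ : 0 ≤ δ) (hu : ‖1 - β • Tu‖ ≤ ρ) (hv : ‖1 - β • Tv‖ ≤ ρ)
    (hDu : Du * Tu = 1) (hDu' : Tu * Du = 1) (hDv : Dv * Tv = 1) (hDv' : Tv * Dv = 1)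
    (hTu : ∀ t τ, blk Tu t τ = Mu (t - τ)) (hTv : ∀ t τ, blk Tv t τ = Mv (t - τ))
    (hMu : ∀ s : ℤ, specNorm (Mu s) ≤ K * gu (s : ℝ) ^ (-κ))
    (hMv : ∀ s : ℤ, specNorm (Mv s) ≤ K * gu (s : ℝ) ^ (-κ))
    (hM : ∀ s : ℤ, specNorm (Mv s - Mu s) ≤ K * δ * gu (s : ℝ) ^ (-κ))
    {n m : ℕ} (hm : 1 ≤ m) {r : ℤ} (hr : ((n * m + m + n * m : ℕ) : ℤ) < |r|)
    {e : ℝ} (he : e = 2 * ((m : ℝ) ^ (-(κ - 1)) / (κ - 1)))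
    (hsmall : ρ + β * (K * e) ≤ (1 + ρ) / 2)
    {G : ℝ} (hGdef : G = β / (1 - (1 + ρ) / 2)) :
    specNorm (blk Du r 0 - blk Dv r 0) ≤
      K * δ * (2 * totalWt κ * G ^ 2 * ((1 + ρ) / 2) ^ n +
        (2 * totalWt κ * G ^ 3 * K + G ^ 2) * e) := by
  set ρ₁ := (1 + ρ) / 2 with hρ₁
  have hρ₁1 : ρ₁ < 1 := by linarith
  have hρρ₁ : ρ ≤ ρ₁ := by linarith
  have hG : 0 ≤ G := by rw [hGdef]; exact div_nonneg hβ.le (by linarith)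
  have hZ := totalWt_nonneg κ
  obtain ⟨Tu', hbu, -, hu'⟩ := exists_banded_approx hκ hK hTu hMu hm
  obtain ⟨Tv', hbv, -, hv'⟩ := exists_banded_approx hκ hK hTv hMv hm
  have hΔ : ∀ t τ, blk (Tv - Tu) t τ = Mv (t - τ) - Mu (t - τ) :=
    fun t τ => by rw [blk_sub, hTu, hTv]
  have hΔn := norm_toeplitz_le (M := fun s => Mv s - Mu s) hκ hΔ hM
  obtain ⟨Δ', hbΔ, hΔ'n, hΔ'⟩ := exists_banded_approx (M := fun s => Mv s - Mu s) hκ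
    (mul_nonneg hK hδ) hΔ hM hm
  rw [← he] at hu' hv' hΔ'
  have hcontr : ∀ {T T' : Hp p →L[ℝ] Hp p}, ‖1 - β • T‖ ≤ ρ → ‖T - T'‖ ≤ K * e →
      ‖1 - β • T'‖ ≤ ρ₁ := fun {T T'} h h' => by
    have e1 : 1 - β • T' = (1 - β • T) + β • (T - T') := by rw [smul_sub]; abel
    rw [e1]
    refine (norm_add_le _ _).trans (le_trans ?_ hsmall)
    rw [norm_smul, Real.norm_of_nonneg hβ.le]
    gcongr
  obtain ⟨Du', hbDu, hDu'n, hDuDu'⟩ := exists_banded_approx_inverse hβ hρ₁1 (hu.trans hρρ₁) hDu'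
    hDu hbu hu' (hcontr hu hu') n
  obtain ⟨Dv', hbDv, hDv'n, hDvDv'⟩ := exists_banded_approx_inverse hβ hρ₁1 (hv.trans hρρ₁) hDv'
    hDv hbv hv' (hcontr hv hv') n
  have hDvn := norm_inverse_le hβ hρ₁1 (hv.trans hρρ₁) hDv
  rw [← hGdef] at hDu'n hDuDu' hDv'n hDvDv' hDvn
  have hb : blk (Du' * Δ' * Dv') r 0 = 0 :=
    ((hbDu.mul hbΔ).mul hbDv).blk_eq_zero (by simpa using hr)
  have e2 : Du - Dv - Du' * Δ' * Dv' =
      (Du - Du') * (Tv - Tu) * Dv + Du' * ((Tv - Tu) - Δ') * Dv + Du' * Δ' * (Dv - Dv') := by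
    have : Du - Dv = Du * (Tv - Tu) * Dv := by
      rw [mul_sub, sub_mul, mul_assoc, hDv', hDu, mul_one, one_mul]
    rw [this]
    noncomm_ring
  have e3 : blk Du r 0 - blk Dv r 0 = blk (Du - Dv - Du' * Δ' * Dv') r 0 := by
    rw [blk_sub, blk_sub, hb, sub_zero]
  rw [e3]
  refine (specNorm_blk_le _ _ _).trans ?_
  rw [e2]
  have hη0 := (norm_nonneg _).trans hDuDu'
  have hΔ0 := (norm_nonneg _).trans hΔn
  have hΔe0 := (norm_nonneg _).trans hΔ'
  calc _ ≤ ‖Du - Du'‖ * ‖Tv - Tu‖ * ‖Dv‖ + ‖Du'‖ * ‖Tv - Tu - Δ'‖ * ‖Dv‖ +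
        ‖Du'‖ * ‖Δ'‖ * ‖Dv - Dv'‖ :=
        norm_add₃_le.trans (add_le_add_three norm_mul₃_le norm_mul₃_le norm_mul₃_le)
    _ ≤ ((ρ₁ ^ n + G * (K * e)) * G) * (K * δ * totalWt κ) * G + G * (K * δ * e) * G +
        G * (K * δ * totalWt κ) * ((ρ₁ ^ n + G * (K * e)) * G) := by gcongr
    _ = _ := by ring

lemma norm_blk_inverse_sub_le (hκ : 1 < κ) (hβ : 0 < β) (hρ0 : 0 ≤ ρ) (hρ : ρ < 1) (hK : 0 ≤ K)
    (hδ : 0 ≤ δ) (hu : ‖1 - β • Tu‖ ≤ ρ) (hv : ‖1 - β • Tv‖ ≤ ρ)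
    (hDu : Du * Tu = 1) (hDu' : Tu * Du = 1) (hDv : Dv * Tv = 1) (hDv' : Tv * Dv = 1)
    (hTu : ∀ t τ, blk Tu t τ = Mu (t - τ)) (hTv : ∀ t τ, blk Tv t τ = Mv (t - τ))
    (hMu : ∀ s : ℤ, specNorm (Mu s) ≤ K * gu (s : ℝ) ^ (-κ))
    (hMv : ∀ s : ℤ, specNorm (Mv s) ≤ K * gu (s : ℝ) ^ (-κ))
    (hM : ∀ s : ℤ, specNorm (Mv s - Mu s) ≤ K * δ * gu (s : ℝ) ^ (-κ)) (r : ℤ) :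
    specNorm (blk Du r 0 - blk Dv r 0) ≤ diffConst κ K β ρ * δ ∧
    ∀ n m : ℕ, 1 ≤ m → ((n * m + m + n * m : ℕ) : ℤ) < |r| →
      specNorm (blk Du r 0 - blk Dv r 0) ≤
        diffConst κ K β ρ * δ * ((m : ℝ) ^ (-(κ - 1)) + ((1 + ρ) / 2) ^ n) := by
  set G := β / (1 - (1 + ρ) / 2) with hG
  set Z := totalWt κ with hZ
  set b := 2 / (κ - 1) with hb
  have ha : 0 < κ - 1 := by linarith
  have hG0 : 0 ≤ G := div_nonneg hβ.le (by linarith)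
  have hZ0 : 0 ≤ Z := totalWt_nonneg κ
  have hb0 : 0 ≤ b := by positivity
  have hgap : 0 < (1 - ρ) / 2 := by linarith
  set P₁ := 2 * Z * G ^ 2 with hP₁
  set P₂ := (2 * Z * G ^ 3 * K + G ^ 2) * b with hP₂
  set P₃ := G ^ 2 * Z * (β * K * b / ((1 - ρ) / 2)) with hP₃
  have hP₁0 : 0 ≤ P₁ := by positivity
  have hP₂0 : 0 ≤ P₂ := by positivity
  have hP₃0 : 0 ≤ P₃ := by positivity
  have hC : diffConst κ K β ρ = K * (P₁ + P₂ + P₃) := rfl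
  have hKδ : 0 ≤ K * δ := mul_nonneg hK hδ
  have htriv : specNorm (blk Du r 0 - blk Dv r 0) ≤ K * δ * (Z * G ^ 2) := by
    rw [← blk_sub]
    exact (specNorm_blk_le _ _ _).trans (norm_inverse_sub_le hκ hβ (by linarith)
      (hu.trans (by linarith)) (hv.trans (by linarith)) hDu hDv hDv' hTu hTv hM)
  have hZG : 0 ≤ Z * G ^ 2 := by positivity
  rw [hC]
  refine ⟨htriv.trans ?_, fun n m hm hr => ?_⟩
  · rw [mul_right_comm]
    gcongr
    linarith
  set y := (m : ℝ) ^ (-(κ - 1)) with hy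
  set w := ((1 + ρ) / 2) ^ n with hw
  have hy0 : 0 ≤ y := by positivity
  have hw0 : 0 ≤ w := by positivity
  have hfin : K * (P₁ + P₂ + P₃) * δ * (y + w) =
      K * δ * (P₁ * w + P₂ * y + P₃ * y + (P₁ * y + P₂ * w + P₃ * w)) := by ring
  have hrest : 0 ≤ P₁ * y + P₂ * w + P₃ * w := by positivity
  rw [hfin]
  by_cases hs : ρ + β * (K * (b * y)) ≤ (1 + ρ) / 2
  · have he : b * y = 2 * (y / (κ - 1)) := by rw [hb]; ring
    refine (norm_blk_inverse_sub_le_of_banded hκ hβ hρ hK hδ hu hv hDu hDu' hDv hDv' hTu hTv hMu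
      hMv hM hm hr he hs hG).trans (mul_le_mul_of_nonneg_left ?_ hKδ)
    change P₁ * w + (2 * Z * G ^ 3 * K + G ^ 2) * (b * y) ≤ _
    have : (2 * Z * G ^ 3 * K + G ^ 2) * (b * y) = P₂ * y := by rw [hP₂]; ring
    have : 0 ≤ P₃ * y := by positivity
    linarith
  · refine htriv.trans ?_
    gcongr
    have h1 : 1 ≤ β * K * b / ((1 - ρ) / 2) * y := by
      rw [div_mul_eq_mul_div, le_div_iff₀ hgap]
      linarith
    have h2 : Z * G ^ 2 ≤ P₃ * y := by
      have := mul_le_mul_of_nonneg_left h1 hZG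
      rw [hP₃]
      linarith
    have : 0 ≤ P₁ * w + P₂ * y := by positivity
    linarith

end Difference

section Logarithm

lemma zeta_pos (x : ℝ) : 0 < zeta x :=
  div_pos (one_pos.trans_le (le_max_left _ _)) (gu_pos x)

/-- A bandwidth `m` of order `|r| / log |r|` and an order `n` of order `log |r|` balance the two
error terms at the rate `ζ(r)^a`. -/
lemma exists_bandwidth {a ρ : ℝ} (ha : 0 < a) (hρ0 : 0 < ρ) (hρ : ρ < 1) :
    ∃ Q : ℝ, 0 < Q ∧ ∀ r : ℤ, 1 ≤ Q * zeta r ^ a ∨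
      ∃ n m : ℕ, 1 ≤ m ∧ ((n * m + m + n * m : ℕ) : ℤ) < |r| ∧
        (m : ℝ) ^ (-a) + ρ ^ n ≤ Q * zeta r ^ a := by
  have hlog : 0 < -Real.log ρ := by linarith [Real.log_neg hρ0 hρ]
  set A := a / -Real.log ρ with hA
  have hA0 : 0 < A := by positivity
  set c := 2 * A + 3 with hc
  have hc0 : 0 < c := by positivity
  refine ⟨(4 * c) ^ a + 1, by positivity, fun r => ?_⟩
  set R := gu (r : ℝ) with hR
  have hR1 : 1 ≤ R := one_le_gu _
  have hR0 : 0 < R := gu_pos _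
  set q := max 1 (Real.log R) with hq
  have hq1 : 1 ≤ q := le_max_left _ _
  have hq0 : 0 < q := by linarith
  have hz : zeta r = q / R := rfl
  have hz0 := zeta_pos r
  have hza : 0 < zeta r ^ a := Real.rpow_pos_of_pos hz0 _
  by_cases hcase : R / (2 * c * q) < 1
  · left
    have h1 : 1 ≤ 4 * c * zeta r := by
      rw [div_lt_one (by positivity)] at hcase
      rw [hz, ← mul_div_assoc, le_div_iff₀ hR0]
      have : 0 < c * q := by positivity
      linarith
    have h2 : 1 ≤ (4 * c) ^ a * zeta r ^ a := by
      rw [← Real.mul_rpow (by positivity) hz0.le]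
      exact Real.one_le_rpow h1 ha.le
    linarith
  · right
    push Not at hcase
    have hRr : R = |(r : ℝ)| := by
      refine max_eq_right ?_
      by_contra! hlt
      have : R = 1 := max_eq_left hlt.le
      rw [this, le_div_iff₀ (by positivity)] at hcase
      have : 1 ≤ c := by linarith
      nlinarith
    set n := ⌈A * q⌉₊ with hn
    set m := ⌊R / (2 * c * q)⌋₊ with hm
    have hm1 : 1 ≤ m := Nat.one_le_floor_iff _ |>.2 hcase
    have hmle : (m : ℝ) ≤ R / (2 * c * q) := Nat.floor_le (by positivity)
    have hmge : R / (4 * c * q) ≤ m := by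
      have h1 : R / (2 * c * q) < m + 1 := Nat.lt_floor_add_one _
      have h2 : (1 : ℝ) ≤ m := by exact_mod_cast hm1
      have h3 : R / (4 * c * q) = R / (2 * c * q) / 2 := by field_simp; ring
      linarith
    have hnge : A * q ≤ n := Nat.le_ceil _
    have hnle : (n : ℝ) < A * q + 1 := Nat.ceil_lt_add_one (by positivity)
    refine ⟨n, m, hm1, ?_, ?_⟩
    · have h1 : ((n * m + m + n * m : ℕ) : ℝ) < |(r : ℝ)| := by
        push_cast
        have h2 : 2 * (n : ℝ) + 1 ≤ c * q := by rw [hc]; linarith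
        calc (n : ℝ) * m + m + n * m = (2 * n + 1) * m := by ring
          _ ≤ c * q * (R / (2 * c * q)) := by gcongr
          _ = R / 2 := by field_simp
          _ < R := by linarith
          _ = |(r : ℝ)| := hRr
      exact_mod_cast h1
    · have h1 : (m : ℝ) ^ (-a) ≤ (4 * c) ^ a * zeta r ^ a := by
        calc (m : ℝ) ^ (-a) ≤ (R / (4 * c * q)) ^ (-a) :=
              Real.rpow_le_rpow_of_nonpos (by positivity) hmge (by linarith)
          _ = (4 * c * zeta r) ^ a := by
            rw [Real.rpow_neg (by positivity), ← Real.inv_rpow (by positivity), inv_div, hz,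
              mul_div_assoc]
          _ = _ := Real.mul_rpow (by positivity) hz0.le
      have h2 : ρ ^ n ≤ zeta r ^ a := by
        rw [← Real.rpow_natCast, Real.rpow_def_of_pos hρ0, Real.rpow_def_of_pos hz0]
        apply Real.exp_le_exp.2
        have h3 : Real.log (zeta r) = Real.log q - Real.log R := by
          rw [hz, Real.log_div hq0.ne' hR0.ne']
        have h4 : 0 ≤ Real.log q := Real.log_nonneg hq1
        have h5 : Real.log R ≤ q := le_max_right _ _
        have h6 : a * q ≤ -Real.log ρ * n := by
          have := mul_le_mul_of_nonneg_left hnge hlog.le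
          rwa [← mul_assoc, hA, mul_div_cancel₀ _ hlog.ne'] at this
        have h7 : a * Real.log R ≤ a * q := by gcongr
        have h8 : 0 ≤ a * Real.log q := by positivity
        rw [h3]
        linarith
      linarith

end Logarithm

end BlockToeplitz

open BlockToeplitz

/-- Theorem 3.4, bound (3.3): for each `u` the block Toeplitz operator `𝐂(u)` is
boundedly invertible, and the Toeplitz blocks `D_r(u)` of `𝐃(u) = 𝐂(u)⁻¹` are Lipschitz
in `u` at the rate `𝒦 |u−v| ζ(r)^{κ−1}`.  The operator `𝐂(u)` is characterised by its
blocks `(𝐂(u))_{t,τ} = C_{t−τ}(u)`, and `D_r(u)` is the block `(𝐃(u))_{r,0}`. -/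
theorem inverse_toeplitz_blocks_lipschitz (K κ lamInf lamSup : ℝ) (N₀ : ℕ)
    (hκ : 3 < κ) (hInf : 0 < lamInf) (hle : lamInf ≤ lamSup) :
    ∃ 𝒦 : ℝ, 0 < 𝒦 ∧
      ∀ (p : ℕ), 1 ≤ p →
        ∀ (C : ℕ → Hp p →L[ℝ] Hp p) (Cr : ℤ → ℝ → Matrix (Fin p) (Fin p) ℝ),
          AssumptionLS p K κ lamInf lamSup N₀ C Cr →
          ∀ (u v : ℝ) (CU CV : Hp p →L[ℝ] Hp p),
            (∀ t τ : ℤ, blk CU t τ = Cr (t - τ) u) →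
            (∀ t τ : ℤ, blk CV t τ = Cr (t - τ) v) →
            ∃ DU DV : Hp p →L[ℝ] Hp p,
              CU.comp DU = ContinuousLinearMap.id ℝ (Hp p) ∧
              DU.comp CU = ContinuousLinearMap.id ℝ (Hp p) ∧
              CV.comp DV = ContinuousLinearMap.id ℝ (Hp p) ∧
              DV.comp CV = ContinuousLinearMap.id ℝ (Hp p) ∧
              ∀ r : ℤ, specNorm (blk DU r 0 - blk DV r 0) ≤
                𝒦 * |u - v| * zeta (r : ℝ) ^ (κ - 1) := by
  have hκ1 : 1 < κ := by linarith
  set B := |K| * totalWt κ + 2 * lamInf with hB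
  have hZ := totalWt_nonneg κ
  have hB2 : 2 * lamInf ≤ B := by
    have : 0 ≤ |K| * totalWt κ := by positivity
    linarith
  have hB0 : 0 < B := by linarith
  set β := lamInf / B ^ 2 with hβ
  have hβ0 : 0 < β := by positivity
  set ρ := √(1 - (lamInf / B) ^ 2) with hρ
  have hρ0 : 0 ≤ ρ := Real.sqrt_nonneg _
  have hρ1 : ρ < 1 := by
    rw [hρ, Real.sqrt_lt' one_pos]
    have : 0 < (lamInf / B) ^ 2 := by positivity
    linarith
  obtain ⟨Q, hQ, hQr⟩ := exists_bandwidth (a := κ - 1) (ρ := (1 + ρ) / 2) (by linarith)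
    (by linarith) (by linarith)
  refine ⟨|diffConst κ |K| β ρ| * Q + 1, by positivity, ?_⟩
  intro p _ C Cr hLS u v CU CV hCU hCV
  have hMb : ∀ (w : ℝ) (s : ℤ), specNorm (Cr s w) ≤ |K| * gu (s : ℝ) ^ (-κ) := fun w s =>
    (hLS.crBound s w).trans (mul_le_mul_of_nonneg_right (le_abs_self K) (gu_rpow_nonneg _ _))
  have hcontr : ∀ (w : ℝ) (T : Hp p →L[ℝ] Hp p), (∀ t τ : ℤ, blk T t τ = Cr (t - τ) w) →
      ‖1 - β • T‖ ≤ ρ := fun w T hT =>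
    norm_one_sub_smul_le hInf hB0
      ((norm_toeplitz_le (M := fun s => Cr s w) hκ1 hT (hMb w)).trans (by linarith))
      (coercive_of_blk_eq hLS hκ1 hT)
  have hu := hcontr u CU hCU
  have hv := hcontr v CV hCV
  obtain ⟨DU, hU, hU'⟩ := exists_inverse (hu.trans_lt hρ1)
  obtain ⟨DV, hV, hV'⟩ := exists_inverse (hv.trans_lt hρ1)
  refine ⟨DU, DV, hU, hU', hV, hV', fun r => ?_⟩
  have hM : ∀ s : ℤ, specNorm (Cr s v - Cr s u) ≤ |K| * |u - v| * gu (s : ℝ) ^ (-κ) := fun s => by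
    refine (hLS.crLip s v u).trans ?_
    rw [abs_sub_comm]
    gcongr
    · exact gu_rpow_nonneg _ _
    · exact le_abs_self K
  obtain ⟨h1, h2⟩ := norm_blk_inverse_sub_le (Mu := fun s => Cr s u) (Mv := fun s => Cr s v) hκ1
    hβ0 hρ0 hρ1 (abs_nonneg K) (abs_nonneg (u - v)) hu hv hU' hU hV' hV hCU hCV (hMb u) (hMb v)
    hM r
  have hz : 0 ≤ zeta (r : ℝ) ^ (κ - 1) := (Real.rpow_pos_of_pos (zeta_pos _) _).le
  have hd := le_abs_self (diffConst κ |K| β ρ)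
  have key : specNorm (blk DU r 0 - blk DV r 0) ≤
      |diffConst κ |K| β ρ| * |u - v| * (Q * zeta (r : ℝ) ^ (κ - 1)) := by
    rcases hQr r with h | ⟨n, m, hm, hnm, h⟩
    · refine h1.trans ((mul_le_mul_of_nonneg_right hd (abs_nonneg _)).trans ?_)
      exact le_mul_of_one_le_right (by positivity) h
    · exact (h2 n m hm hnm).trans (by gcongr)
  calc specNorm (blk DU r 0 - blk DV r 0)
      ≤ |diffConst κ |K| β ρ| * Q * (|u - v| * zeta (r : ℝ) ^ (κ - 1)) := by linarith
    _ ≤ (|diffConst κ |K| β ρ| * Q + 1) * (|u - v| * zeta (r : ℝ) ^ (κ - 1)) := by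
      gcongr
      linarith
    _ = _ := by ring
end
end

section
/- Local stationary approximation of the inverse covariance (Theorem 3.4, bound (3.4)). Fix K < ∞, κ > 3, 0 < λ_inf ≤ λ_sup < ∞ and N₀ ∈ ℕ. There exists a constant 𝒦 < ∞, depending only on K, κ, λ_inf, λ_sup, such that whenever Assumption LS(p, K, κ, λ_inf, λ_sup, N₀) holds: for every N ≥ N₀ the operators 𝐂^(N) and 𝐂(u) (u ∈ ℝ) are boundedly invertible, and, writing 𝐃^(N) = (𝐂^(N))⁻¹ and 𝐃(u) = 𝐂(u)⁻¹, the blocks satisfy ‖[𝐃^(N) − 𝐃(t/N)]_{t,τ}‖₂ ≤ 𝒦 ζ(t−τ)^{κ−2} min(1/N, 2ζ(t−τ)) for all t, τ ∈ ℤ. -/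
noncomputable section

open Filter Topology

/-- The weight `⟨r⟩^{-α}` on the integers. -/
def decayWeight (α : ℝ) (r : ℤ) : ℝ := gu (r : ℝ) ^ (-α)

lemma one_le_gu (x : ℝ) : 1 ≤ gu x := le_max_left _ _

lemma gu_pos (x : ℝ) : 0 < gu x := one_pos.trans_le (one_le_gu x)

lemma abs_le_gu (x : ℝ) : |x| ≤ gu x := le_max_right _ _

lemma gu_add_le (x y : ℝ) : gu (x + y) ≤ 2 * max (gu x) (gu y) := by
  have h1 := le_max_left (gu x) (gu y)
  have h2 := le_max_right (gu x) (gu y)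
  refine max_le (by linarith [one_le_gu x]) ?_
  linarith [abs_add_le x y, abs_le_gu x, abs_le_gu y]

lemma decayWeight_pos (α : ℝ) (r : ℤ) : 0 < decayWeight α r := Real.rpow_pos_of_pos (gu_pos _) _

lemma decayWeight_zero (α : ℝ) : decayWeight α 0 = 1 := by simp [decayWeight, gu]

lemma decayWeight_anti {α β : ℝ} (h : α ≤ β) (r : ℤ) : decayWeight β r ≤ decayWeight α r :=
  Real.rpow_le_rpow_of_exponent_le (one_le_gu _) (by linarith)

lemma decayWeight_le_one {α : ℝ} (h : 0 ≤ α) (r : ℤ) : decayWeight α r ≤ 1 :=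
  Real.rpow_le_one_of_one_le_of_nonpos (one_le_gu _) (by linarith)

lemma gu_mul_decayWeight (α : ℝ) (r : ℤ) :
    gu (r : ℝ) * decayWeight α r = decayWeight (α - 1) r := by
  have h := gu_pos (r : ℝ)
  rw [decayWeight, decayWeight, show -(α - 1) = 1 + -α by ring, Real.rpow_add h, Real.rpow_one]

lemma sqrt_decayWeight (α : ℝ) (r : ℤ) : √(decayWeight α r) = decayWeight (α / 2) r := by
  rw [decayWeight, decayWeight, Real.sqrt_eq_rpow, ← Real.rpow_mul (gu_pos _).le]
  ring_nf

lemma summable_decayWeight {α : ℝ} (h : 1 < α) : Summable (decayWeight α) := by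
  have h0 : Summable fun n : ℤ => if n = 0 then (1 : ℝ) else 0 :=
    (hasSum_ite_eq (0 : ℤ) (1 : ℝ)).summable
  refine ((Real.summable_abs_int_rpow h).add h0).of_nonneg_of_le
    (fun r => (decayWeight_pos α r).le) fun r => ?_
  by_cases hr : r = 0
  · subst hr
    rw [decayWeight_zero, if_pos rfl]
    have := Real.rpow_nonneg (abs_nonneg ((0 : ℤ) : ℝ)) (-α)
    linarith
  · have h1 : (1 : ℝ) ≤ |(r : ℝ)| := by exact_mod_cast Int.one_le_abs hr
    rw [if_neg hr, add_zero, decayWeight, gu, max_eq_right h1]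

/-- The convolution constant of the weight `⟨r⟩^{-α}`. -/
def convConst (α β : ℝ) : ℝ := 2 ^ α * (2 * ∑' r, decayWeight β r)

lemma tsum_decayWeight_pos {α : ℝ} (h : 1 < α) : 0 < ∑' r, decayWeight α r :=
  (summable_decayWeight h).tsum_pos (fun r => (decayWeight_pos α r).le) 0 (decayWeight_pos α 0)

lemma convConst_pos {α β : ℝ} (h : 1 < β) : 0 < convConst α β := by
  have := tsum_decayWeight_pos h
  unfold convConst
  positivity

lemma hasSum_decayWeight_add {β : ℝ} (h : 1 < β) (t τ : ℤ) :
    HasSum (fun s => decayWeight β (t - s) + decayWeight β (s - τ))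
      (2 * ∑' r, decayWeight β r) := by
  have hs := (summable_decayWeight h).hasSum
  rw [two_mul]
  exact ((Equiv.subLeft t).hasSum_iff.mpr hs).add ((Equiv.subRight τ).hasSum_iff.mpr hs)

lemma decayWeight_le_of_gu_le {α : ℝ} (h : 0 ≤ α) {r s : ℤ} (hrs : gu (r : ℝ) ≤ 2 * gu (s : ℝ)) :
    decayWeight α s ≤ 2 ^ α * decayWeight α r := by
  have h2 : (0 : ℝ) < 2 := two_pos
  have h1 : (2 * gu (s : ℝ)) ^ (-α) ≤ gu (r : ℝ) ^ (-α) :=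
    Real.rpow_le_rpow_of_nonpos (gu_pos _) hrs (by linarith)
  rw [Real.mul_rpow h2.le (gu_pos _).le, Real.rpow_neg h2.le] at h1
  have h3 : (0 : ℝ) < 2 ^ α := by positivity
  rw [inv_mul_le_iff₀ h3] at h1
  exact h1

lemma decayWeight_dichotomy {α : ℝ} (h : 0 ≤ α) (t s τ : ℤ) :
    decayWeight α (t - s) ≤ 2 ^ α * decayWeight α (t - τ) ∨
      decayWeight α (s - τ) ≤ 2 ^ α * decayWeight α (t - τ) := by
  have key := gu_add_le ((t - s : ℤ) : ℝ) ((s - τ : ℤ) : ℝ)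
  rw [← Int.cast_add, sub_add_sub_cancel] at key
  rcases le_total (gu ((t - s : ℤ) : ℝ)) (gu ((s - τ : ℤ) : ℝ)) with h1 | h1
  · exact .inr (decayWeight_le_of_gu_le h (by rwa [max_eq_right h1] at key))
  · exact .inl (decayWeight_le_of_gu_le h (by rwa [max_eq_left h1] at key))

/-- If two kernels are dominated by the weight `⟨r⟩^{-α}` and by a summable weight simultaneously,
their product is dominated by a summable function with total `⟨t-τ⟩^{-α}`. -/
lemma mul_le_of_decay {α β a b a' b' x y : ℝ} (hα : 0 ≤ α) (hy : 0 ≤ y) (ha : 0 ≤ a) (hb : 0 ≤ b)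
    (ha' : 0 ≤ a') (hb' : 0 ≤ b') (t s τ : ℤ) (hxa : x ≤ a * decayWeight α (t - s))
    (hxa' : x ≤ a' * decayWeight β (t - s)) (hyb : y ≤ b * decayWeight α (s - τ))
    (hyb' : y ≤ b' * decayWeight β (s - τ)) :
    x * y ≤ max (a * b') (a' * b) * (2 ^ α * decayWeight α (t - τ)) *
      (decayWeight β (t - s) + decayWeight β (s - τ)) := by
  have w1 := (decayWeight_pos β (t - s)).le
  have w2 := (decayWeight_pos β (s - τ)).le
  have w := (decayWeight_pos α (t - τ)).le
  have w3 := (decayWeight_pos α (t - s)).le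
  have w4 := (decayWeight_pos α (s - τ)).le
  have m1 := le_max_left (a * b') (a' * b)
  have m2 := le_max_right (a * b') (a' * b)
  have hm : 0 ≤ max (a * b') (a' * b) := le_trans (by positivity) m1
  rcases decayWeight_dichotomy hα t s τ with h | h
  · calc x * y ≤ (a * (2 ^ α * decayWeight α (t - τ))) * (b' * decayWeight β (s - τ)) :=
          mul_le_mul (hxa.trans (by gcongr)) hyb' hy (by positivity)
      _ = a * b' * (2 ^ α * decayWeight α (t - τ)) * decayWeight β (s - τ) := by ring
      _ ≤ _ := by gcongr; linarith
  · calc x * y ≤ (a' * decayWeight β (t - s)) * (b * (2 ^ α * decayWeight α (t - τ))) :=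
          mul_le_mul hxa' (hyb.trans (by gcongr)) hy (by positivity)
      _ = a' * b * (2 ^ α * decayWeight α (t - τ)) * decayWeight β (t - s) := by ring
      _ ≤ _ := by gcongr; linarith

/-- The block `A_{t,τ}` as a continuous linear map. -/
def blockMap {p : ℕ} (A : Hp p →L[ℝ] Hp p) (t τ : ℤ) :
    EuclideanSpace ℝ (Fin p) →L[ℝ] EuclideanSpace ℝ (Fin p) :=
  (lp.singleContinuousLinearMap ℝ (fun _ : ℤ => EuclideanSpace ℝ (Fin p)) 2 t).adjoint ∘L A ∘L
    lp.singleContinuousLinearMap ℝ (fun _ : ℤ => EuclideanSpace ℝ (Fin p)) 2 τ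

section Blocks

variable {p : ℕ}

lemma inner_blockMap (A : Hp p →L[ℝ] Hp p) (t τ : ℤ) (x y : EuclideanSpace ℝ (Fin p)) :
    inner ℝ x (blockMap A t τ y) = inner ℝ (lp.single 2 t x : Hp p) (A (lp.single 2 τ y)) := by
  rw [blockMap, ContinuousLinearMap.comp_apply, ContinuousLinearMap.adjoint_inner_right]
  rfl

lemma blockMap_apply (A : Hp p →L[ℝ] Hp p) (t τ : ℤ) (y : EuclideanSpace ℝ (Fin p)) :
    blockMap A t τ y = A (lp.single 2 τ y) t :=
  ext_inner_left ℝ fun x => by rw [inner_blockMap, lp.inner_single_left]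

lemma blockMap_sub (A B : Hp p →L[ℝ] Hp p) (t τ : ℤ) :
    blockMap (A - B) t τ = blockMap A t τ - blockMap B t τ := by
  ext1 y; simp [blockMap_apply]

lemma blockMap_add (A B : Hp p →L[ℝ] Hp p) (t τ : ℤ) :
    blockMap (A + B) t τ = blockMap A t τ + blockMap B t τ := by
  ext1 y; simp [blockMap_apply]

lemma blockMap_smul (c : ℝ) (A : Hp p →L[ℝ] Hp p) (t τ : ℤ) :
    blockMap (c • A) t τ = c • blockMap A t τ := by
  ext1 y; simp [blockMap_apply]

lemma norm_blockMap_le (A : Hp p →L[ℝ] Hp p) (t τ : ℤ) : ‖blockMap A t τ‖ ≤ ‖A‖ := by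
  refine ContinuousLinearMap.opNorm_le_bound _ (norm_nonneg _) fun y => ?_
  rw [blockMap_apply]
  calc _ ≤ ‖A (lp.single 2 τ y)‖ := lp.norm_apply_le_norm two_ne_zero _ _
    _ ≤ ‖A‖ * ‖(lp.single 2 τ y : Hp p)‖ := A.le_opNorm _
    _ = _ := by rw [lp.norm_single (by norm_num)]

lemma toEuclideanLin_blk (A : Hp p →L[ℝ] Hp p) (t τ : ℤ) :
    LinearMap.toContinuousLinearMap (Matrix.toEuclideanLin (blk A t τ)) = blockMap A t τ := by
  apply ContinuousLinearMap.coe_injective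
  refine (EuclideanSpace.basisFun (Fin p) ℝ).toBasis.ext fun b => ?_
  ext a
  have h := lp.inner_single_left (𝕜 := ℝ) t (EuclideanSpace.single a (1 : ℝ))
    (A (lp.single 2 τ (EuclideanSpace.single b 1)))
  simpa [blk, bvec, blockMap_apply, Matrix.toLpLin_apply, EuclideanSpace.inner_single_left] using h

lemma specNorm_blk (A : Hp p →L[ℝ] Hp p) (t τ : ℤ) : specNorm (blk A t τ) = ‖blockMap A t τ‖ := by
  rw [specNorm, toEuclideanLin_blk]

lemma hasSum_blockMap_comp (A B : Hp p →L[ℝ] Hp p) (t τ : ℤ) (x : EuclideanSpace ℝ (Fin p)) :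
    HasSum (fun s => blockMap A t s (blockMap B s τ x)) (blockMap (A * B) t τ x) := by
  have h := (lp.hasSum_single ENNReal.ofNat_ne_top (B (lp.single 2 τ x))).mapL
    ((lp.singleContinuousLinearMap ℝ (fun _ : ℤ => EuclideanSpace ℝ (Fin p)) 2 t).adjoint ∘L A)
  simp_rw [blockMap_apply B]
  exact h

lemma norm_blockMap_mul_le {A B : Hp p →L[ℝ] Hp p} {t τ : ℤ} {f : ℤ → ℝ} {σ : ℝ}
    (hf : HasSum f σ) (h : ∀ s, ‖blockMap A t s‖ * ‖blockMap B s τ‖ ≤ f s) :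
    ‖blockMap (A * B) t τ‖ ≤ σ := by
  have h0 : 0 ≤ σ := hf.nonneg fun s => le_trans (by positivity) (h s)
  refine ContinuousLinearMap.opNorm_le_bound _ h0 fun x => ?_
  refine (hasSum_blockMap_comp A B t τ x).norm_le_of_bounded (hf.mul_right ‖x‖) fun s => ?_
  calc _ ≤ ‖blockMap A t s‖ * (‖blockMap B s τ‖ * ‖x‖) :=
        (ContinuousLinearMap.le_opNorm _ _).trans (by gcongr; exact ContinuousLinearMap.le_opNorm _ _)
    _ ≤ f s * ‖x‖ := by rw [← mul_assoc]; gcongr; exact h s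

/-- Off-diagonal decay of the blocks: `‖A_{t,τ}‖ ≤ c ⟨t-τ⟩^{-α}`. -/
def HasDecay (α c : ℝ) (A : Hp p →L[ℝ] Hp p) : Prop :=
  ∀ t τ : ℤ, ‖blockMap A t τ‖ ≤ c * decayWeight α (t - τ)

lemma HasDecay.nonneg {α c : ℝ} {A : Hp p →L[ℝ] Hp p} (h : HasDecay α c A) : 0 ≤ c :=
  nonneg_of_mul_nonneg_left ((norm_nonneg _).trans (h 0 0)) (decayWeight_pos _ _)

lemma HasDecay.mono {α c c' : ℝ} {A : Hp p →L[ℝ] Hp p} (h : HasDecay α c A) (hc : c ≤ c') :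
    HasDecay α c' A := fun t τ => (h t τ).trans (by have := decayWeight_pos α (t - τ); gcongr)

lemma HasDecay.anti {α β c : ℝ} {A : Hp p →L[ℝ] Hp p} (h : HasDecay α c A) (hβ : β ≤ α) :
    HasDecay β c A := fun t τ => (h t τ).trans
  (mul_le_mul_of_nonneg_left (decayWeight_anti hβ _) h.nonneg)

lemma HasDecay.add {α a b : ℝ} {A B : Hp p →L[ℝ] Hp p} (hA : HasDecay α a A)
    (hB : HasDecay α b B) : HasDecay α (a + b) (A + B) := fun t τ => by
  rw [blockMap_add, add_mul]
  exact (norm_add_le _ _).trans (add_le_add (hA t τ) (hB t τ))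

lemma HasDecay.smul {α a : ℝ} {A : Hp p →L[ℝ] Hp p} (hA : HasDecay α a A) (c : ℝ) :
    HasDecay α (|c| * a) (c • A) := fun t τ => by
  rw [blockMap_smul, norm_smul, Real.norm_eq_abs, mul_assoc]
  exact mul_le_mul_of_nonneg_left (hA t τ) (abs_nonneg c)

lemma hasDecay_one (α : ℝ) : HasDecay α 1 (1 : Hp p →L[ℝ] Hp p) := fun t τ => by
  rw [one_mul]
  by_cases h : t = τ
  · rw [h, sub_self, decayWeight_zero]
    exact (norm_blockMap_le _ _ _).trans ContinuousLinearMap.norm_id_le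
  · have : blockMap (1 : Hp p →L[ℝ] Hp p) t τ = 0 := by
      ext1 y
      simp [blockMap_apply, Pi.single_eq_of_ne h]
    rw [this, norm_zero]
    exact (decayWeight_pos _ _).le

/-- A bound for the row `t` of a product needs decay of the first factor along that row only. -/
lemma norm_blockMap_mul_le_of_row {α a b : ℝ} (hα : 1 < α) (ha : 0 ≤ a) {A B : Hp p →L[ℝ] Hp p}
    {t : ℤ} (hA : ∀ s, ‖blockMap A t s‖ ≤ a * decayWeight α (t - s)) (hB : HasDecay α b B) (τ : ℤ) :
    ‖blockMap (A * B) t τ‖ ≤ convConst α α * a * b * decayWeight α (t - τ) := by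
  refine (norm_blockMap_mul_le ((hasSum_decayWeight_add hα t τ).mul_left _) fun s =>
    mul_le_of_decay (by linarith) (norm_nonneg _) ha hB.nonneg ha hB.nonneg t s τ
      (hA s) (hA s) (hB s τ) (hB s τ)).trans_eq ?_
  rw [max_self, convConst]
  ring

lemma HasDecay.mul {α a b : ℝ} (hα : 1 < α) {A B : Hp p →L[ℝ] Hp p} (hA : HasDecay α a A)
    (hB : HasDecay α b B) : HasDecay α (convConst α α * a * b) (A * B) := fun t τ =>
  norm_blockMap_mul_le_of_row hα hA.nonneg (hA t) hB τ

lemma HasDecay.sq {α c q : ℝ} (hα : 2 < α) {A : Hp p →L[ℝ] Hp p} (hA : HasDecay α c A)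
    (hq : ‖A‖ ≤ q) : HasDecay α (convConst α (α / 2) * c * √(q * c)) (A * A) := fun t τ => by
  have hc := hA.nonneg
  have hq0 : 0 ≤ q := (norm_nonneg _).trans hq
  have hsqrt : ∀ t s, ‖blockMap A t s‖ ≤ √(q * c) * decayWeight (α / 2) (t - s) := fun t s => by
    rw [← sqrt_decayWeight, ← Real.sqrt_mul (by positivity)]
    refine Real.le_sqrt_of_sq_le ?_
    rw [pow_two, mul_assoc]
    exact mul_le_mul ((norm_blockMap_le A t s).trans hq) (hA t s) (norm_nonneg _) hq0
  refine (norm_blockMap_mul_le ((hasSum_decayWeight_add (by linarith : 1 < α / 2) t τ).mul_left _)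
    fun s => mul_le_of_decay (by linarith) (norm_nonneg _) hc hc (Real.sqrt_nonneg _)
      (Real.sqrt_nonneg _) t s τ (hA t s) (hsqrt t s) (hA s τ) (hsqrt s τ)).trans_eq ?_
  rw [mul_comm (√(q * c)) c, max_self, convConst]
  ring

end Blocks

section InverseDecay

lemma summable_exp_sub_exp_pow (l : ℝ) {m : ℝ} (hm : 0 < m) :
    Summable fun n : ℕ => Real.exp (l * (3 / 2) ^ n - m * 2 ^ n) := by
  have h1 : Tendsto (fun n : ℕ => (n : ℝ) * (1 / 2) ^ n + l * (3 / 4) ^ n - m) atTop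
      (𝓝 (0 + l * 0 - m)) := by
    refine ((tendsto_self_mul_const_pow_of_lt_one (by norm_num) (by norm_num)).add
      ((tendsto_pow_atTop_nhds_zero_of_lt_one (by norm_num) (by norm_num)).const_mul l)).sub_const m
  have h2 := h1.eventually_lt_const (show 0 + l * 0 - m < 0 by linarith)
  refine Real.summable_exp_neg_nat.of_norm_bounded_eventually_nat ?_
  filter_upwards [h2] with n hn
  rw [Real.norm_eq_abs, abs_of_pos (Real.exp_pos _), Real.exp_le_exp]
  have h3 : (0 : ℝ) < 2 ^ n := by positivity
  have h4 := mul_neg_of_neg_of_pos hn h3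
  have h5 : ((1 : ℝ) / 2) ^ n * 2 ^ n = 1 := by rw [← mul_pow]; norm_num
  have h6 : ((3 : ℝ) / 4) ^ n * 2 ^ n = (3 / 2) ^ n := by rw [← mul_pow]; norm_num
  have h7 : ((n : ℝ) * (1 / 2) ^ n + l * (3 / 4) ^ n - m) * 2 ^ n
      = n * ((1 / 2) ^ n * 2 ^ n) + l * ((3 / 4) ^ n * 2 ^ n) - m * 2 ^ n := by ring
  rw [h7, h5, h6] at h4
  linarith

variable {p : ℕ}

lemma norm_pow_two_pow_le {A : Hp p →L[ℝ] Hp p} {m : ℝ} (h : ‖A‖ ≤ Real.exp (-m)) (n : ℕ) :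
    ‖A ^ 2 ^ n‖ ≤ Real.exp (-(m * 2 ^ n)) := by
  refine (norm_pow_le' A (by positivity)).trans ?_
  refine (pow_le_pow_left₀ (norm_nonneg _) h _).trans_eq ?_
  rw [← Real.exp_nat_mul]
  push_cast
  ring_nf

/-- Off-diagonal decay of the iterated squares of a contraction: the decay constants eventually
decrease as fast as the operator norms. -/
lemma HasDecay.pow_two_pow {α c m : ℝ} (hα : 2 < α) (hc : 0 < c) {A : Hp p →L[ℝ] Hp p}
    (hA : HasDecay α c A) (h : ‖A‖ ≤ Real.exp (-m)) (n : ℕ) :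
    HasDecay α ((convConst α (α / 2))⁻¹ ^ 2 * Real.exp
      ((Real.log (convConst α (α / 2) ^ 2 * c) + m) * (3 / 2) ^ n - m * 2 ^ n)) (A ^ 2 ^ n) := by
  have hG : 0 < convConst α (α / 2) := convConst_pos (by linarith)
  set G := convConst α (α / 2)
  set l := Real.log (G ^ 2 * c) + m with hl
  induction n with
  | zero =>
    simp only [pow_zero, pow_one, mul_one]
    refine hA.mono (le_of_eq ?_)
    rw [hl, add_sub_cancel_right, Real.exp_log (by positivity)]
    field_simp
  | succ n ih =>
    rw [show A ^ 2 ^ (n + 1) = A ^ 2 ^ n * A ^ 2 ^ n by rw [pow_succ (2 : ℕ) n, pow_mul, pow_two]]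
    refine (ih.sq hα (norm_pow_two_pow_le h n)).mono (le_of_eq ?_)
    have hsq : Real.exp (-(m * 2 ^ n)) * (G⁻¹ ^ 2 * Real.exp (l * (3 / 2) ^ n - m * 2 ^ n)) =
        (G⁻¹ * Real.exp (l * (3 / 2) ^ n / 2 - m * 2 ^ n)) ^ 2 := by
      rw [mul_pow, ← Real.exp_nat_mul, mul_left_comm, ← Real.exp_add]
      congr 2
      push_cast
      ring
    rw [hsq, Real.sqrt_sq (by positivity)]
    have he : Real.exp (l * (3 / 2) ^ (n + 1) - m * 2 ^ (n + 1)) =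
        Real.exp (l * (3 / 2) ^ n - m * 2 ^ n) * Real.exp (l * (3 / 2) ^ n / 2 - m * 2 ^ n) := by
      rw [← Real.exp_add]
      congr 1
      ring
    rw [he]
    field_simp
    rfl

lemma exists_hasDecay_partial_neumann {α : ℝ} (hα : 1 < α) {A : Hp p →L[ℝ] Hp p} {c : ℕ → ℝ}
    (hA : ∀ n, HasDecay α (c n) (A ^ 2 ^ n)) (M : ℕ) :
    ∃ S : Hp p →L[ℝ] Hp p, HasDecay α (∏ n ∈ Finset.range M, (1 + convConst α α * c n)) S ∧
      (1 - A) * S = 1 - A ^ 2 ^ M := by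
  induction M with
  | zero => exact ⟨1, by simpa using hasDecay_one α, by simp⟩
  | succ M ih =>
    obtain ⟨S, hS, hS'⟩ := ih
    refine ⟨S + S * A ^ 2 ^ M, (hS.add (hS.mul hα (hA M))).mono (le_of_eq ?_), ?_⟩
    · rw [Finset.prod_range_succ]
      ring
    · rw [mul_add, ← mul_assoc, hS', pow_succ 2 M, pow_mul, pow_two]
      noncomm_ring

/-- Quantitative inverse-closedness: if `A` is a strict contraction with off-diagonal decay then
`(1 - A)⁻¹` has the same decay, with a constant depending only on the decay constant and on the
norm bound. -/
lemma exists_hasDecay_inverse_one_sub {α c m : ℝ} (hα : 2 < α) (hc : 0 < c) (hm : 0 < m) :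
    ∃ c' : ℝ, 0 < c' ∧ ∀ (p : ℕ) (A D : Hp p →L[ℝ] Hp p), HasDecay α c A →
      ‖A‖ ≤ Real.exp (-m) → D * (1 - A) = 1 → HasDecay α c' D := by
  set l := Real.log (convConst α (α / 2) ^ 2 * c) + m with hl
  set f : ℕ → ℝ := fun n => convConst α α * ((convConst α (α / 2))⁻¹ ^ 2 *
    Real.exp (l * (3 / 2) ^ n - m * 2 ^ n)) with hf
  have hW : 0 < convConst α α := convConst_pos (by linarith)
  have hf0 : ∀ n, 0 ≤ f n := fun n => by positivity
  have hfs : Summable f := ((summable_exp_sub_exp_pow l hm).mul_left _).mul_left _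
  refine ⟨Real.exp (∑' n, f n), Real.exp_pos _, fun p A D hA hAm hD t τ => ?_⟩
  have hbound : ∀ M : ℕ, ‖blockMap D t τ‖ ≤
      Real.exp (∑' n, f n) * decayWeight α (t - τ) + ‖D‖ * Real.exp (-m) ^ M := fun M => by
    obtain ⟨S, hS, hS'⟩ := exists_hasDecay_partial_neumann (by linarith)
      (hA.pow_two_pow hα hc hAm) M
    have hS1 : HasDecay α (Real.exp (∑' n, f n)) S := hS.mono
      ((Real.prod_one_add_le_exp_sum _ hf0).trans
        (Real.exp_le_exp.mpr (hfs.sum_le_tsum _ fun n _ => hf0 n)))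
    have hDS : D = S + D * A ^ 2 ^ M := by
      have := congrArg (D * ·) hS'
      simp only [← mul_assoc, hD, one_mul, mul_sub, mul_one] at this
      rw [this]
      abel
    have hpow : Real.exp (-(m * 2 ^ M)) ≤ Real.exp (-m) ^ M := by
      rw [← Real.exp_nat_mul, Real.exp_le_exp]
      have : (M : ℝ) ≤ 2 ^ M := by exact_mod_cast Nat.lt_two_pow_self.le
      nlinarith
    calc ‖blockMap D t τ‖ = ‖blockMap S t τ + blockMap (D * A ^ 2 ^ M) t τ‖ := by
          rw [← blockMap_add, ← hDS]
      _ ≤ _ := (norm_add_le _ _).trans (add_le_add (hS1 t τ) ((norm_blockMap_le _ t τ).trans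
          ((norm_mul_le _ _).trans (mul_le_mul_of_nonneg_left
            ((norm_pow_two_pow_le hAm M).trans hpow) (norm_nonneg _)))))
  have hlim : Tendsto (fun M : ℕ => Real.exp (∑' n, f n) * decayWeight α (t - τ) +
      ‖D‖ * Real.exp (-m) ^ M) atTop
      (𝓝 (Real.exp (∑' n, f n) * decayWeight α (t - τ) + ‖D‖ * 0)) :=
    ((tendsto_pow_atTop_nhds_zero_of_lt_one (Real.exp_pos _).le
      (Real.exp_lt_one_iff.mpr (by linarith))).const_mul _).const_add _
  rw [mul_zero, add_zero] at hlim
  exact ge_of_tendsto' hlim hbound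

lemma exists_hasDecay_inverse {α K lam m : ℝ} (hα : 2 < α) (hlam : 0 < lam) (hm : 0 < m) :
    ∃ c : ℝ, 0 < c ∧ ∀ (p : ℕ) (C D : Hp p →L[ℝ] Hp p), HasDecay α K C →
      ‖1 - lam⁻¹ • C‖ ≤ Real.exp (-m) → D * C = 1 → HasDecay α c D := by
  obtain ⟨c, hc, h⟩ := exists_hasDecay_inverse_one_sub (c := 1 + lam⁻¹ * |K|) hα (by positivity) hm
  refine ⟨lam⁻¹ * c, by positivity, fun p C D hC hn hD => ?_⟩
  have hA : HasDecay α (1 + lam⁻¹ * |K|) (1 - lam⁻¹ • C) := by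
    rw [sub_eq_add_neg, ← neg_smul]
    refine (hasDecay_one α).add (((hC.mono (le_abs_self K)).smul _).mono (le_of_eq ?_))
    rw [abs_neg, abs_of_pos (inv_pos.mpr hlam)]
  have hDA : (lam • D) * (1 - (1 - lam⁻¹ • C)) = 1 := by
    rw [sub_sub_cancel, smul_mul_smul_comm, hD, mul_inv_cancel₀ hlam.ne', one_smul]
  have := (h p _ _ hA hn hDA).smul lam⁻¹
  rwa [smul_smul, inv_mul_cancel₀ hlam.ne', one_smul, abs_of_pos (inv_pos.mpr hlam)] at this

lemma exists_inverse_of_norm_lt {C : Hp p →L[ℝ] Hp p} {lam : ℝ}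
    (h : ‖1 - lam⁻¹ • C‖ < 1) : ∃ D : Hp p →L[ℝ] Hp p, C * D = 1 ∧ D * C = 1 := by
  obtain ⟨u, hu⟩ := isUnit_one_sub_of_norm_lt_one h
  rw [sub_sub_cancel] at hu
  refine ⟨lam⁻¹ • (↑u⁻¹ : Hp p →L[ℝ] Hp p), ?_, ?_⟩
  · rw [mul_smul_comm, ← smul_mul_assoc, ← hu, Units.mul_inv]
  · rw [smul_mul_assoc, ← mul_smul_comm, ← hu, Units.inv_mul]

end InverseDecay

section Approximation

variable {p : ℕ}

lemma norm_one_sub_smul_le {C : Hp p →L[ℝ] Hp p} {lamInf lamSup : ℝ} (hInf : 0 < lamInf)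
    (hle : lamInf ≤ lamSup) (hsymm : ∀ x y, inner ℝ (C x) y = inner ℝ x (C y))
    (hlow : ∀ v, lamInf * ‖v‖ ^ 2 ≤ inner ℝ v (C v))
    (hup : ∀ v, inner ℝ v (C v) ≤ lamSup * ‖v‖ ^ 2) :
    ‖1 - lamSup⁻¹ • C‖ ≤ Real.exp (-(lamInf / lamSup)) := by
  have hSup : 0 < lamSup := hInf.trans_le hle
  have hq : 1 - lamInf / lamSup ≤ Real.exp (-(lamInf / lamSup)) := by
    linarith [Real.add_one_le_exp (-(lamInf / lamSup))]
  refine le_trans ?_ hq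
  have hT : (1 - lamSup⁻¹ • C : Hp p →L[ℝ] Hp p).IsSymmetric := fun x y => by
    simp [inner_sub_left, inner_sub_right, inner_smul_left, inner_smul_right, hsymm]
  rw [ContinuousLinearMap.norm_eq_iSup_rayleighQuotient _ hT]
  have h1 : lamInf / lamSup ≤ 1 := (div_le_one hSup).mpr hle
  refine ciSup_le fun v => ?_
  rcases eq_or_ne v 0 with rfl | hv
  · simpa using h1
  have hv2 : 0 < ‖v‖ ^ 2 := by positivity
  have hre : (1 - lamSup⁻¹ • C : Hp p →L[ℝ] Hp p).reApplyInnerSelf v =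
      ‖v‖ ^ 2 - lamSup⁻¹ * inner ℝ v (C v) := by
    simp [ContinuousLinearMap.reApplyInnerSelf_apply, inner_sub_left, inner_smul_left, hsymm]
  have h2 : lamSup⁻¹ * inner ℝ v (C v) ≤ ‖v‖ ^ 2 := by
    rw [inv_mul_le_iff₀ hSup]; exact hup v
  have h3 : lamInf / lamSup * ‖v‖ ^ 2 ≤ lamSup⁻¹ * inner ℝ v (C v) := by
    rw [div_eq_inv_mul, mul_assoc]
    exact mul_le_mul_of_nonneg_left (hlow v) (by positivity)
  rw [ContinuousLinearMap.rayleighQuotient, hre, abs_of_nonneg (div_nonneg (by linarith) hv2.le),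
    div_le_iff₀ hv2]
  linarith

lemma norm_sq_sum_single_add (m : ℤ) (f : ℤ → EuclideanSpace ℝ (Fin p)) (s : Finset ℤ) :
    ‖∑ i ∈ s, (lp.single 2 (m + i) (f i) : Hp p)‖ ^ 2 = ∑ i ∈ s, ‖f i‖ ^ 2 := by
  have h := lp.norm_sum_single (E := fun _ : ℤ => EuclideanSpace ℝ (Fin p)) (p := 2) (by norm_num)
    (fun i => f (i - m)) (s.map (addLeftEmbedding m))
  simpa using h

lemma inner_sum_single (A : Hp p →L[ℝ] Hp p) (m : ℤ) (x y : ℤ → EuclideanSpace ℝ (Fin p))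
    (s : Finset ℤ) :
    inner ℝ (∑ i ∈ s, (lp.single 2 (m + i) (x i) : Hp p))
      (A (∑ j ∈ s, (lp.single 2 (m + j) (y j) : Hp p))) =
      ∑ i ∈ s, ∑ j ∈ s, inner ℝ (x i) (blockMap A (m + i) (m + j) (y j)) := by
  simp_rw [map_sum, sum_inner, inner_sum, inner_blockMap]

/-- Operator norm bounds are inherited by limits along shifts of the blocks. -/
lemma norm_le_of_tendsto_blockMap_shift {B : ℕ → Hp p →L[ℝ] Hp p} {T : Hp p →L[ℝ] Hp p} {q : ℝ}
    {m : ℕ → ℤ} (hq : 0 ≤ q) (hB : ∀ᶠ N in atTop, ‖B N‖ ≤ q)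
    (hlim : ∀ i j, Tendsto (fun N => blockMap (B N) (m N + i) (m N + j)) atTop
      (𝓝 (blockMap T i j))) : ‖T‖ ≤ q := by
  have hfin : ∀ (x y : Hp p) (s : Finset ℤ),
      inner ℝ (∑ i ∈ s, (lp.single 2 i (x i) : Hp p)) (T (∑ i ∈ s, (lp.single 2 i (y i) : Hp p))) ≤
        q * (‖∑ i ∈ s, (lp.single 2 i (x i) : Hp p)‖ *
          ‖∑ i ∈ s, (lp.single 2 i (y i) : Hp p)‖) := fun x y s => by
    have hnorm : ∀ (k : ℤ) (z : Hp p), ‖∑ i ∈ s, (lp.single 2 (k + i) (z i) : Hp p)‖ =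
        ‖∑ i ∈ s, (lp.single 2 i (z i) : Hp p)‖ := fun k z => by
      rw [← sq_eq_sq₀ (norm_nonneg _) (norm_nonneg _), norm_sq_sum_single_add]
      simpa using (norm_sq_sum_single_add 0 z s).symm
    have h0 := inner_sum_single T 0 x y s
    simp only [zero_add] at h0
    rw [h0]
    refine le_of_tendsto (tendsto_finsetSum _ fun i _ => tendsto_finsetSum _ fun j _ =>
      tendsto_const_nhds.inner 
        (((ContinuousLinearMap.apply ℝ _ (y j)).continuous.tendsto _).comp (hlim i j))) ?_
    filter_upwards [hB] with N hN
    refine (inner_sum_single (B N) (m N) x y s).symm.trans_le ?_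
    refine (real_inner_le_norm _ _).trans ?_
    refine (mul_le_mul_of_nonneg_left ((B N).le_of_opNorm_le hN _) (norm_nonneg _)).trans_eq ?_
    rw [hnorm, hnorm]
    ring
  have hall : ∀ x y : Hp p, inner ℝ x (T y) ≤ q * (‖x‖ * ‖y‖) := fun x y => by
    have hx : Tendsto (fun s : Finset ℤ => ∑ i ∈ s, (lp.single 2 i (x i) : Hp p)) atTop (𝓝 x) :=
      lp.hasSum_single ENNReal.ofNat_ne_top x
    have hy : Tendsto (fun s : Finset ℤ => ∑ i ∈ s, (lp.single 2 i (y i) : Hp p)) atTop (𝓝 y) :=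
      lp.hasSum_single ENNReal.ofNat_ne_top y
    exact le_of_tendsto_of_tendsto' (hx.inner ((T.continuous.tendsto y).comp hy))
      ((hx.norm.mul hy.norm).const_mul q) (hfin x y)
  refine T.opNorm_le_bound hq fun y => ?_
  rcases eq_or_ne (T y) 0 with h | h
  · rw [h, norm_zero]; positivity
  · have h1 := hall (T y) y
    rw [real_inner_self_eq_norm_sq] at h1
    have h2 : 0 < ‖T y‖ := norm_pos_iff.mpr h
    nlinarith

lemma specNorm_sub (M M' : Matrix (Fin p) (Fin p) ℝ) :
    specNorm (M - M') = ‖LinearMap.toContinuousLinearMap (Matrix.toEuclideanLin M) -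
      LinearMap.toContinuousLinearMap (Matrix.toEuclideanLin M')‖ := by
  rw [specNorm, map_sub, map_sub]

variable {K κ lamInf lamSup : ℝ} {N₀ : ℕ} {C : ℕ → Hp p →L[ℝ] Hp p}
  {Cr : ℤ → ℝ → Matrix (Fin p) (Fin p) ℝ}

lemma AssumptionLS.hasDecay (h : AssumptionLS p K κ lamInf lamSup N₀ C Cr) {N : ℕ} (hN : 1 ≤ N) :
    HasDecay κ K (C N) := fun t τ => by
  rw [← specNorm_blk, decayWeight, Int.cast_sub]
  exact h.decay N hN t τ

lemma AssumptionLS.hasDecay_toeplitz (h : AssumptionLS p K κ lamInf lamSup N₀ C Cr) {u : ℝ}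
    {CU : Hp p →L[ℝ] Hp p} (hCU : ∀ t τ : ℤ, blk CU t τ = Cr (t - τ) u) :
    HasDecay κ K CU := fun t τ => by
  rw [← specNorm_blk, hCU]
  exact h.crBound _ u

lemma AssumptionLS.norm_blockMap_sub_le (h : AssumptionLS p K κ lamInf lamSup N₀ C Cr) {u : ℝ}
    {CU : Hp p →L[ℝ] Hp p} (hCU : ∀ t τ : ℤ, blk CU t τ = Cr (t - τ) u) {N : ℕ} (hN : 1 ≤ N)
    {t τ i j : ℤ} (hij : i - j = t - τ) :
    ‖blockMap (C N) t τ - blockMap CU i j‖ ≤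
      K * (1 / N + |(t : ℝ) / N - u|) * decayWeight (κ - 1) (t - τ) := by
  have hK : 0 ≤ K := (h.hasDecay hN).nonneg
  have h1 := h.approx N hN t τ
  have h2 := h.crLip (t - τ) ((t : ℝ) / N) u
  rw [specNorm_sub, toEuclideanLin_blk] at h1
  rw [specNorm_sub, ← hij, ← hCU i j, toEuclideanLin_blk, hij] at h2
  refine (norm_sub_le_norm_sub_add_norm_sub _ _ _).trans ((add_le_add h1 h2).trans ?_)
  have e1 : gu ((t : ℝ) - τ) ^ (-κ + 1) = decayWeight (κ - 1) (t - τ) := by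
    rw [decayWeight, Int.cast_sub]; ring_nf
  have e2 : gu ((t - τ : ℤ) : ℝ) ^ (-κ) ≤ decayWeight (κ - 1) (t - τ) :=
    decayWeight_anti (by linarith) _
  have w := (decayWeight_pos (κ - 1) (t - τ)).le
  rw [e1]
  calc _ ≤ K * decayWeight (κ - 1) (t - τ) * (1 / N) +
        K * |(t : ℝ) / N - u| * decayWeight (κ - 1) (t - τ) :=
        add_le_add (mul_le_mul_of_nonneg_left (min_le_left _ _) (by positivity))
          (mul_le_mul_of_nonneg_left e2 (by positivity))
    _ = _ := by ring

lemma AssumptionLS.norm_one_sub_le (h : AssumptionLS p K κ lamInf lamSup N₀ C Cr)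
    (hInf : 0 < lamInf) (hle : lamInf ≤ lamSup) {N : ℕ} (hN : N₀ ≤ N) :
    ‖1 - lamSup⁻¹ • C N‖ ≤ Real.exp (-(lamInf / lamSup)) :=
  norm_one_sub_smul_le hInf hle (h.symm N) (h.lower N hN) (h.upper N hN)

lemma blockMap_one_add (m i j : ℤ) :
    blockMap (1 : Hp p →L[ℝ] Hp p) (m + i) (m + j) = blockMap 1 i j := by
  ext1 y
  simp only [blockMap_apply, one_apply_eq_self, lp.single_apply]
  by_cases hij : i = j
  · subst hij; simp
  · rw [Pi.single_eq_of_ne hij, Pi.single_eq_of_ne (by simpa using hij)]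

lemma AssumptionLS.norm_one_sub_toeplitz_le (h : AssumptionLS p K κ lamInf lamSup N₀ C Cr)
    (hκ : 1 ≤ κ) (hInf : 0 < lamInf) (hle : lamInf ≤ lamSup) {u : ℝ}
    {CU : Hp p →L[ℝ] Hp p} (hCU : ∀ t τ : ℤ, blk CU t τ = Cr (t - τ) u) :
    ‖1 - lamSup⁻¹ • CU‖ ≤ Real.exp (-(lamInf / lamSup)) := by
  have hK : 0 ≤ K := (h.hasDecay le_rfl).nonneg
  refine norm_le_of_tendsto_blockMap_shift (B := fun N => 1 - lamSup⁻¹ • C N)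
    (m := fun N => ⌊u * N⌋) (Real.exp_pos _).le ?_ fun i j => ?_
  · filter_upwards [eventually_ge_atTop N₀] with N hN
    exact h.norm_one_sub_le hInf hle hN
  · simp only [blockMap_sub, blockMap_smul, blockMap_one_add]
    refine tendsto_const_nhds.sub (Tendsto.const_smul ?_ _)
    rw [tendsto_iff_norm_sub_tendsto_zero]
    have hlim : Tendsto (fun N : ℕ => K * (2 + |(i : ℝ)|) * (1 / (N : ℝ))) atTop
        (𝓝 (K * (2 + |(i : ℝ)|) * 0)) := tendsto_one_div_atTop_nhds_zero_nat.const_mul _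
    rw [mul_zero] at hlim
    refine squeeze_zero' (.of_forall fun _ => norm_nonneg _) ?_ hlim
    filter_upwards [eventually_ge_atTop 1] with N hN
    have hN' : (0 : ℝ) < N := by exact_mod_cast hN
    refine (h.norm_blockMap_sub_le hCU hN (by ring)).trans ?_
    have h1 : |((⌊u * N⌋ + i : ℤ) : ℝ) / N - u| ≤ (1 + |(i : ℝ)|) * (1 / N) := by
      have e : ((⌊u * N⌋ + i : ℤ) : ℝ) / N - u = ((⌊u * N⌋ - u * N) + i) * (1 / N) := by
        push_cast; field_simp; ring
      rw [e, abs_mul, abs_of_pos (one_div_pos.mpr hN')]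
      gcongr
      refine (abs_add_le _ _).trans (add_le_add_left ?_ _)
      rw [abs_sub_comm, abs_le]
      constructor <;> linarith [Int.floor_le (u * N), Int.lt_floor_add_one (u * N)]
    have h2 := decayWeight_le_one (show 0 ≤ κ - 1 by linarith) (⌊u * N⌋ + i - (⌊u * N⌋ + j))
    have w := (decayWeight_pos (κ - 1) (⌊u * N⌋ + i - (⌊u * N⌋ + j))).le
    calc _ ≤ K * (1 / N + (1 + |(i : ℝ)|) * (1 / N)) * 1 := by gcongr
      _ = _ := by ring

lemma AssumptionLS.norm_blockMap_inverse_sub_le (h : AssumptionLS p K κ lamInf lamSup N₀ C Cr)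
    (hκ : 2 < κ) {N : ℕ} (hN : 1 ≤ N) {t : ℤ} {CU DU DN : Hp p →L[ℝ] Hp p}
    (hCU : ∀ s₁ s₂ : ℤ, blk CU s₁ s₂ = Cr (s₁ - s₂) ((t : ℝ) / N)) (hDU : DU * CU = 1)
    (hDN : C N * DN = 1) {c : ℝ} (hcU : HasDecay κ c DU) (hcN : HasDecay κ c DN) (τ : ℤ) :
    ‖blockMap (DN - DU) t τ‖ ≤
      convConst (κ - 1) (κ - 1) ^ 2 * c ^ 2 * (2 * K) * (1 / N) * decayWeight (κ - 1) (t - τ) := by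
  have hκ' : 1 < κ - 1 := by linarith
  have hK : 0 ≤ K := (h.hasDecay hN).nonneg
  have hc := hcU.nonneg
  have hN' : (0 : ℝ) < N := by exact_mod_cast hN
  have hW : 0 < convConst (κ - 1) (κ - 1) := convConst_pos hκ'
  have hE : ∀ s s' : ℤ, ‖blockMap (CU - C N) s s'‖ ≤
      gu ((t - s : ℤ) : ℝ) * (2 * K * (1 / N) * decayWeight (κ - 1) (s - s')) := fun s s' => by
    rw [blockMap_sub, norm_sub_rev]
    refine (h.norm_blockMap_sub_le hCU hN rfl).trans ?_
    have w := (decayWeight_pos (κ - 1) (s - s')).le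
    have e : |(s : ℝ) / N - t / N| = |((t - s : ℤ) : ℝ)| * (1 / N) := by
      rw [← sub_div, abs_div, abs_of_pos hN', abs_sub_comm, Int.cast_sub]
      ring
    have g1 := one_le_gu ((t - s : ℤ) : ℝ)
    have g2 := abs_le_gu ((t - s : ℤ) : ℝ)
    rw [e]
    calc _ ≤ K * (gu ((t - s : ℤ) : ℝ) * (1 / N) + gu ((t - s : ℤ) : ℝ) * (1 / N)) *
          decayWeight (κ - 1) (s - s') := by
          gcongr
          exact le_mul_of_one_le_left (by positivity) g1
      _ = _ := by ring
  have hrow : ∀ s', ‖blockMap (DU * (CU - C N)) t s'‖ ≤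
      convConst (κ - 1) (κ - 1) * c * (2 * K * (1 / N)) * decayWeight (κ - 1) (t - s') :=
      fun s' => by
    refine (norm_blockMap_mul_le ((hasSum_decayWeight_add hκ' t s').mul_left
      (max (c * (2 * K * (1 / N))) (c * (2 * K * (1 / N))) *
        (2 ^ (κ - 1) * decayWeight (κ - 1) (t - s')))) fun s => ?_).trans_eq ?_
    · have hg := gu_pos ((t - s : ℤ) : ℝ)
      have hx : gu ((t - s : ℤ) : ℝ) * ‖blockMap DU t s‖ ≤ c * decayWeight (κ - 1) (t - s) := by
        rw [← gu_mul_decayWeight, mul_left_comm]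
        exact mul_le_mul_of_nonneg_left (hcU t s) hg.le
      have hy : (gu ((t - s : ℤ) : ℝ))⁻¹ * ‖blockMap (CU - C N) s s'‖ ≤
          2 * K * (1 / N) * decayWeight (κ - 1) (s - s') := by
        rw [inv_mul_le_iff₀ hg]
        exact hE s s'
      refine le_of_eq_of_le ?_ (mul_le_of_decay (by linarith) (by positivity) hc (by positivity) hc
        (by positivity) t s s' hx hx hy hy)
      field_simp
    · rw [max_self, convConst]
      ring
  have hD : DN - DU = DU * (CU - C N) * DN := by
    rw [mul_sub, hDU, sub_mul, one_mul, mul_assoc, hDN, mul_one]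
  rw [hD]
  refine (norm_blockMap_mul_le_of_row hκ' (by positivity) hrow
    (hcN.anti (by linarith : κ - 1 ≤ κ)) τ).trans_eq ?_
  ring

end Approximation

lemma zeta_pos (x : ℝ) : 0 < zeta x :=
  div_pos (one_pos.trans_le (le_max_left _ _)) (gu_pos x)

lemma decayWeight_le_zeta_rpow {α : ℝ} (hα : 0 ≤ α) (r : ℤ) :
    decayWeight α r ≤ zeta (r : ℝ) ^ α := by
  rw [decayWeight, Real.rpow_neg (gu_pos _).le, ← Real.inv_rpow (gu_pos _).le]
  refine Real.rpow_le_rpow (inv_nonneg.mpr (gu_pos _).le) ?_ hα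
  rw [zeta, ← one_div]
  exact div_le_div_of_nonneg_right (le_max_left _ _) (gu_pos _).le

/-- Theorem 3.4, bound (3.4): the inverse covariance `𝐃^(N) = (𝐂^(N))⁻¹` is locally
approximated by the inverse Toeplitz operators `𝐃(t/N) = 𝐂(t/N)⁻¹`, with blockwise error
`𝒦 ζ(t−τ)^{κ−2} min(1/N, 2ζ(t−τ))`.  The operators `𝐂(u)` are characterised by their
blocks `C_{t−τ}(u)`, and both kinds of inverses are asserted to exist. -/
theorem inverse_covariance_local_approximation (K κ lamInf lamSup : ℝ) (N₀ : ℕ)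
    (hκ : 3 < κ) (hInf : 0 < lamInf) (hle : lamInf ≤ lamSup) :
    ∃ 𝒦 : ℝ, 0 < 𝒦 ∧
      ∀ (p : ℕ), 1 ≤ p →
        ∀ (C : ℕ → Hp p →L[ℝ] Hp p) (Cr : ℤ → ℝ → Matrix (Fin p) (Fin p) ℝ),
          AssumptionLS p K κ lamInf lamSup N₀ C Cr →
          -- each `𝐂(u)` is boundedly invertible
          (∀ (u : ℝ) (CU : Hp p →L[ℝ] Hp p),
            (∀ t τ : ℤ, blk CU t τ = Cr (t - τ) u) →
            ∃ DU : Hp p →L[ℝ] Hp p,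
              CU.comp DU = ContinuousLinearMap.id ℝ (Hp p) ∧
              DU.comp CU = ContinuousLinearMap.id ℝ (Hp p)) ∧
          -- each `𝐂^(N)` (for `N ≥ N₀`) is boundedly invertible, and the blocks of its
          -- inverse are locally approximated by the blocks of `𝐃(t/N)`
          ∀ N : ℕ, N₀ ≤ N → 1 ≤ N →
            ∃ DN : Hp p →L[ℝ] Hp p,
              (C N).comp DN = ContinuousLinearMap.id ℝ (Hp p) ∧
              DN.comp (C N) = ContinuousLinearMap.id ℝ (Hp p) ∧
              ∀ (t τ : ℤ) (CU DU : Hp p →L[ℝ] Hp p),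
                (∀ s₁ s₂ : ℤ, blk CU s₁ s₂ = Cr (s₁ - s₂) ((t : ℝ) / (N : ℝ))) →
                CU.comp DU = ContinuousLinearMap.id ℝ (Hp p) →
                DU.comp CU = ContinuousLinearMap.id ℝ (Hp p) →
                specNorm (blk DN t τ - blk DU t τ) ≤
                  𝒦 * zeta ((t : ℝ) - (τ : ℝ)) ^ (κ - 2) *
                    min (1 / (N : ℝ)) (2 * zeta ((t : ℝ) - (τ : ℝ))) := by
  have hSup : 0 < lamSup := hInf.trans_le hle
  have hm : 0 < lamInf / lamSup := div_pos hInf hSup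
  have hexp : Real.exp (-(lamInf / lamSup)) < 1 := Real.exp_lt_one_iff.mpr (by linarith)
  obtain ⟨c, hc, hdecay⟩ :=
    exists_hasDecay_inverse (K := K) (by linarith : 2 < κ) hSup hm
  set b := convConst (κ - 1) (κ - 1) ^ 2 * c ^ 2 * (2 * |K|) with hb
  have hb0 : 0 ≤ b := by positivity
  refine ⟨b + c, by positivity, fun p _ C Cr h => ⟨fun u CU hCU => ?_, fun N hN₀ hN => ?_⟩⟩
  · exact exists_inverse_of_norm_lt
      ((h.norm_one_sub_toeplitz_le (by linarith) hInf hle hCU).trans_lt hexp)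
  have hK : 0 ≤ K := (h.hasDecay hN).nonneg
  have hCN := h.norm_one_sub_le hInf hle hN₀
  obtain ⟨DN, hDN, hDN'⟩ := exists_inverse_of_norm_lt (hCN.trans_lt hexp)
  refine ⟨DN, hDN, hDN', fun t τ CU DU hCU _ hDU => ?_⟩
  have hcN := hdecay p _ DN (h.hasDecay hN) hCN hDN'
  have hcU := hdecay p CU DU (h.hasDecay_toeplitz hCU)
    (h.norm_one_sub_toeplitz_le (by linarith) hInf hle hCU) hDU
  have hdiff := h.norm_blockMap_inverse_sub_le (by linarith) hN hCU hDU hDN hcU hcN τ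
  rw [specNorm_sub, toEuclideanLin_blk, toEuclideanLin_blk, ← blockMap_sub, ← Int.cast_sub]
  have hz := zeta_pos ((t - τ : ℤ) : ℝ)
  have hz' : 0 ≤ zeta ((t - τ : ℤ) : ℝ) ^ (κ - 2) := Real.rpow_nonneg hz.le _
  rw [mul_min_of_nonneg _ _ (by positivity)]
  refine le_min (hdiff.trans ?_) ?_
  · rw [← abs_of_nonneg hK, ← hb]
    have hw : decayWeight (κ - 1) (t - τ) ≤ zeta ((t - τ : ℤ) : ℝ) ^ (κ - 2) :=
      (decayWeight_anti (by linarith) _).trans (decayWeight_le_zeta_rpow (by linarith) _)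
    calc b * (1 / N) * decayWeight (κ - 1) (t - τ) ≤
          (b + c) * (1 / N) * zeta ((t - τ : ℤ) : ℝ) ^ (κ - 2) := by
          have hbc : b ≤ b + c := by linarith
          have w := (decayWeight_pos (κ - 1) (t - τ)).le
          gcongr
      _ = _ := by ring
  · have hw : decayWeight κ (t - τ) ≤ zeta ((t - τ : ℤ) : ℝ) ^ (κ - 2) *
        zeta ((t - τ : ℤ) : ℝ) := by
      refine (decayWeight_anti (by linarith : κ - 1 ≤ κ) _).trans
        ((decayWeight_le_zeta_rpow (by linarith) _).trans_eq ?_)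
      rw [← Real.rpow_add_one hz.ne']
      ring_nf
    calc ‖blockMap (DN - DU) t τ‖ ≤ c * decayWeight κ (t - τ) + c * decayWeight κ (t - τ) := by
          rw [blockMap_sub]
          exact (norm_sub_le _ _).trans (add_le_add (hcN t τ) (hcU t τ))
      _ = 2 * c * decayWeight κ (t - τ) := by ring
      _ ≤ 2 * (b + c) * (zeta ((t - τ : ℤ) : ℝ) ^ (κ - 2) * zeta ((t - τ : ℤ) : ℝ)) := by
          have w := (decayWeight_pos κ (t - τ)).le
          gcongr
          linarith
      _ = _ := by ring
end
end
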